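/- arXiv:1607.03315 — 3 statements merged into one kernel-verified Lean document; each statement's English description precedes it below -/
import Mathlib

section
/- Let F be a field of characteristic 0 (for instance F = ℚ). Then the set of conjunctions of lattice equations that admit a non-trivial satisfying assignment in the subspace lattice Lt(F^d) for some finite d ≥ 1 is not decidable: there is no algorithm which, given a conjunction of lattice equations, decides whether there exist a finite d ≥ 1 and subspaces of F^d, not all equal, satisfying all its equations (with ⊓ interpreted as intersection and ⊔ as sum of subspaces). -/
/-- Lattice terms in countably many variables. -/
inductive LatTerm : Type where
  | var : ℕ → LatTerm
  | sup : LatTerm → LatTerm → LatTerm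
  | inf : LatTerm → LatTerm → LatTerm

/-- Evaluation of a lattice term under an assignment `v`. -/
def LatTerm.eval {L : Type*} [Lattice L] (v : ℕ → L) : LatTerm → L
  | .var i => v i
  | .sup s t => s.eval v ⊔ t.eval v
  | .inf s t => s.eval v ⊓ t.eval v

/-- The variables occurring in a lattice term. -/
def LatTerm.vars : LatTerm → Finset ℕ
  | .var i => {i}
  | .sup s t => s.vars ∪ t.vars
  | .inf s t => s.vars ∪ t.vars

/-- An injective Gödel numbering of lattice terms. -/
def LatTerm.code : LatTerm → ℕ
  | .var i => 3 * i
  | .sup s t => 3 * Nat.pair s.code t.code + 1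
  | .inf s t => 3 * Nat.pair s.code t.code + 2

/-- A conjunction of lattice equations `s = t`, as a finite list of pairs. -/
abbrev LatConj : Type := List (LatTerm × LatTerm)

/-- The variables occurring in a conjunction of lattice equations. -/
def LatConj.vars (Φ : LatConj) : Finset ℕ :=
  Φ.foldr (fun p s => p.1.vars ∪ p.2.vars ∪ s) ∅

/-- A (natural) Gödel numbering of conjunctions of lattice equations. -/
def LatConj.code (Φ : LatConj) : ℕ :=
  Encodable.encode (Φ.map fun p => Nat.pair p.1.code p.2.code)

/-- `Φ` is satisfied by the assignment `v`. -/
def LatConj.Sat {L : Type*} [Lattice L] (Φ : LatConj) (v : ℕ → L) : Prop :=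
  ∀ p ∈ Φ, p.1.eval v = p.2.eval v

/-- The assignment `v` is non-trivial for `Φ`: not all (occurring) variables get
the same value. -/
def LatConj.Nontriv {L : Type*} (Φ : LatConj) (v : ℕ → L) : Prop :=
  ∃ i ∈ Φ.vars, ∃ j ∈ Φ.vars, v i ≠ v j

/-- Terms in the language of semirings with variables in `σ`. -/
inductive RingTerm (σ : Type) : Type where
  | var : σ → RingTerm σ
  | zero : RingTerm σ
  | one : RingTerm σ
  | add : RingTerm σ → RingTerm σ → RingTerm σ
  | mul : RingTerm σ → RingTerm σ → RingTerm σ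

namespace RingTerm

/-- Evaluation of a semiring term. -/
def eval {σ : Type} {R : Type*} [Semiring R] (ρ : σ → R) : RingTerm σ → R
  | var i => ρ i
  | zero => 0
  | one => 1
  | add s t => s.eval ρ + t.eval ρ
  | mul s t => s.eval ρ * t.eval ρ

/-- Renaming of variables. -/
def rename {σ τ : Type} (g : σ → τ) : RingTerm σ → RingTerm τ
  | var i => var (g i)
  | zero => zero
  | one => one
  | add s t => add (s.rename g) (t.rename g)
  | mul s t => mul (s.rename g) (t.rename g)

theorem eval_rename {σ τ : Type} {R : Type*} [Semiring R] (g : σ → τ) (ρ : τ → R)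
    (t : RingTerm σ) : (t.rename g).eval ρ = t.eval fun i => ρ (g i) := by
  induction t <;> simp_all [rename, eval]

/-- The numeral `1 + (1 + ⋯)`. -/
def num {σ : Type} : ℕ → RingTerm σ
  | 0 => zero
  | n + 1 => add one (num n)

theorem eval_num {σ : Type} {R : Type*} [Semiring R] (ρ : σ → R) (n : ℕ) :
    (num n : RingTerm σ).eval ρ = n := by
  induction n with
  | zero => simp [num, eval]
  | succ n ih => simp [num, eval, ih, add_comm]

end RingTerm

/-! ### Coordinatization: from ring equations to lattice equations

The lattice variables `0, …, 5` stand for the bottom element, three independent subspaces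
`A`, `B`, `C`, and the graphs `P`, `Q` of isomorphisms `A ≃ B`, `B ≃ C`. A linear operator `f` is
represented by the subspace of all `x - f x` with `x ∈ A`, `f x ∈ B`. -/

namespace Coord

open LatTerm

/-- The lattice variable of the `i`-th operator. -/
def opVar {σ : Type} [Encodable σ] (i : σ) : ℕ := Encodable.encode i + 6

/-- Transport of an operator graph from `A ⊔ B` to `A ⊔ C`. -/
def toAC (X : LatTerm) : LatTerm := inf (sup X (var 5)) (sup (var 1) (var 3))

/-- Transport of an operator graph from `A ⊔ C` to `A ⊔ B`. -/
def toAB (X : LatTerm) : LatTerm := inf (sup X (var 5)) (sup (var 1) (var 2))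

/-- Transport of an operator graph from `A ⊔ B` to `B ⊔ C`. -/
def toBC (X : LatTerm) : LatTerm := inf (sup (var 4) (toAC X)) (sup (var 2) (var 3))

/-- The lattice term of the composition of two operators. -/
def mulTerm (X Y : LatTerm) : LatTerm :=
  toAB (inf (sup Y (toBC X)) (sup (var 1) (var 3)))

/-- The lattice term of the sum of two operators. -/
def addTerm (X Y : LatTerm) : LatTerm :=
  toAB (inf (sup X (var 3)) (sup (toAC Y) (var 2)))

/-- The lattice term computing the graph of a ring term. -/
def latTerm {σ : Type} [Encodable σ] : RingTerm σ → LatTerm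
  | .var i => var (opVar i)
  | .zero => var 1
  | .one => var 4
  | .add s t => addTerm (latTerm s) (latTerm t)
  | .mul s t => mulTerm (latTerm s) (latTerm t)

/-- The lattice equations describing the coordinate frame. -/
def frameEqs : LatConj :=
  [(inf (var 1) (var 2), var 0),
   (inf (sup (var 1) (var 2)) (var 3), var 0),
   (inf (var 4) (var 1), var 0), (inf (var 4) (var 2), var 0),
   (sup (var 4) (var 1), sup (var 1) (var 2)), (sup (var 4) (var 2), sup (var 1) (var 2)),
   (inf (var 5) (var 2), var 0), (inf (var 5) (var 3), var 0),
   (sup (var 5) (var 2), sup (var 2) (var 3)), (sup (var 5) (var 3), sup (var 2) (var 3))]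

/-- The lattice equations saying that the `i`-th operator variable is a graph. -/
def graphEqs {σ : Type} [Encodable σ] (i : σ) : LatConj :=
  [(inf (var (opVar i)) (var 2), var 0),
   (sup (var (opVar i)) (var 2), sup (var 1) (var 2))]

/-- The frame equations and the graph equations of all operators. -/
noncomputable def baseEqs (σ : Type) [Encodable σ] [Fintype σ] : LatConj :=
  frameEqs ++ (Finset.univ : Finset σ).toList.flatMap graphEqs

/-- The lattice equation of an equation between ring terms. -/
def latEq {σ : Type} [Encodable σ] (p : RingTerm σ × RingTerm σ) : LatTerm × LatTerm :=
  (latTerm p.1, latTerm p.2)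

/-- The conjunction of lattice equations coordinatizing a system of ring equations. -/
noncomputable def latConj {σ : Type} [Encodable σ] [Fintype σ]
    (E : List (RingTerm σ × RingTerm σ)) : LatConj :=
  E.map latEq ++ baseEqs σ

/-- The lattice variables in use. -/
def Used (σ : Type) [Encodable σ] (k : ℕ) : Prop := k < 6 ∨ ∃ i : σ, k = opVar i

theorem used_of_mem_vars_latTerm {σ : Type} [Encodable σ] (t : RingTerm σ) {k : ℕ}
    (hk : k ∈ (latTerm t).vars) : Used σ k := by
  induction t with
  | var i => right; exact ⟨i, by simpa [latTerm, LatTerm.vars] using hk⟩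
  | zero => left; simp [latTerm, LatTerm.vars] at hk; omega
  | one => left; simp [latTerm, LatTerm.vars] at hk; omega
  | add s t hs ht =>
    simp only [latTerm, addTerm, toAC, toAB, LatTerm.vars, Finset.mem_union,
      Finset.mem_singleton] at hk
    by_cases h1 : k ∈ (latTerm s).vars
    · exact hs h1
    by_cases h2 : k ∈ (latTerm t).vars
    · exact ht h2
    left; simp only [h1, h2, false_or] at hk; omega
  | mul s t hs ht =>
    simp only [latTerm, mulTerm, toAC, toAB, toBC, LatTerm.vars, Finset.mem_union,
      Finset.mem_singleton] at hk
    by_cases h1 : k ∈ (latTerm s).vars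
    · exact hs h1
    by_cases h2 : k ∈ (latTerm t).vars
    · exact ht h2
    left; simp only [h1, h2, false_or] at hk; omega

theorem mem_vars_iff (Φ : LatConj) (k : ℕ) :
    k ∈ Φ.vars ↔ ∃ p ∈ Φ, k ∈ p.1.vars ∨ k ∈ p.2.vars := by
  induction Φ with
  | nil => simp [LatConj.vars]
  | cons p Φ ih =>
    have : LatConj.vars (p :: Φ) = p.1.vars ∪ p.2.vars ∪ LatConj.vars Φ := rfl
    rw [this, Finset.mem_union, Finset.mem_union, ih]
    simp

theorem used_of_mem_vars {σ : Type} [Encodable σ] [Fintype σ]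
    (E : List (RingTerm σ × RingTerm σ)) {p : LatTerm × LatTerm} (hp : p ∈ latConj E) {k : ℕ}
    (hk : k ∈ p.1.vars ∨ k ∈ p.2.vars) : Used σ k := by
  simp only [latConj, baseEqs, List.mem_append, List.mem_map, List.mem_flatMap,
    Finset.mem_toList, Finset.mem_univ, true_and] at hp
  rcases hp with ⟨q, -, rfl⟩ | hp | ⟨i, hi⟩
  · exact hk.elim (used_of_mem_vars_latTerm _) (used_of_mem_vars_latTerm _)
  · left
    simp only [frameEqs, List.mem_cons, List.not_mem_nil, or_false] at hp
    rcases hp with rfl | rfl | rfl | rfl | rfl | rfl | rfl | rfl | rfl | rfl <;>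
      simp [LatTerm.vars] at hk <;> omega
  · simp only [graphEqs, List.mem_cons, List.not_mem_nil, or_false] at hi
    by_cases h : k = opVar i
    · exact Or.inr ⟨i, h⟩
    · left
      rcases hi with rfl | rfl <;> simp [LatTerm.vars, h] at hk <;> omega

/-- A partial lattice homomorphism commutes with the evaluation of terms. -/
theorem eval_partialHom {L L' : Type*} [Lattice L] [Lattice L'] (φ : L → L') (good : L → Prop)
    (hsup : ∀ x y, good x → good y → good (x ⊔ y) ∧ φ (x ⊔ y) = φ x ⊔ φ y)
    (hinf : ∀ x y, good x → good y → good (x ⊓ y) ∧ φ (x ⊓ y) = φ x ⊓ φ y)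
    (v : ℕ → L) (t : LatTerm) (hv : ∀ k ∈ t.vars, good (v k)) :
    good (t.eval v) ∧ φ (t.eval v) = t.eval fun k => φ (v k) := by
  induction t with
  | var i => exact ⟨hv i (by simp [LatTerm.vars]), rfl⟩
  | sup s t hs ht =>
    obtain ⟨gs, es⟩ := hs fun k hk => hv k (by simp [LatTerm.vars, hk])
    obtain ⟨gt, et⟩ := ht fun k hk => hv k (by simp [LatTerm.vars, hk])
    exact ⟨(hsup _ _ gs gt).1, by simp only [LatTerm.eval, (hsup _ _ gs gt).2, es, et]⟩
  | inf s t hs ht =>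
    obtain ⟨gs, es⟩ := hs fun k hk => hv k (by simp [LatTerm.vars, hk])
    obtain ⟨gt, et⟩ := ht fun k hk => hv k (by simp [LatTerm.vars, hk])
    exact ⟨(hinf _ _ gs gt).1, by simp only [LatTerm.eval, (hinf _ _ gs gt).2, es, et]⟩

theorem sat_partialHom {σ : Type} [Encodable σ] [Fintype σ]
    {E : List (RingTerm σ × RingTerm σ)} {L L' : Type*} [Lattice L] [Lattice L']
    (φ : L → L') (good : L → Prop)
    (hsup : ∀ x y, good x → good y → good (x ⊔ y) ∧ φ (x ⊔ y) = φ x ⊔ φ y)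
    (hinf : ∀ x y, good x → good y → good (x ⊓ y) ∧ φ (x ⊓ y) = φ x ⊓ φ y)
    {v : ℕ → L} (hv : ∀ k, Used σ k → good (v k)) (h : (latConj E).Sat v) :
    (latConj E).Sat fun k => φ (v k) := by
  intro p hp
  rw [← (eval_partialHom φ good hsup hinf v p.1 fun k hk =>
      hv k (used_of_mem_vars E hp (Or.inl hk))).2,
    ← (eval_partialHom φ good hsup hinf v p.2 fun k hk =>
      hv k (used_of_mem_vars E hp (Or.inr hk))).2, h p hp]

theorem sat_iff {σ : Type} [Encodable σ] [Fintype σ] {E : List (RingTerm σ × RingTerm σ)}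
    {L : Type*} [Lattice L] {v : ℕ → L} :
    (latConj E).Sat v ↔ (∀ p ∈ E, (latTerm p.1).eval v = (latTerm p.2).eval v) ∧
      (v 1 ⊓ v 2 = v 0 ∧ (v 1 ⊔ v 2) ⊓ v 3 = v 0 ∧ v 4 ⊓ v 1 = v 0 ∧ v 4 ⊓ v 2 = v 0 ∧
        v 4 ⊔ v 1 = v 1 ⊔ v 2 ∧ v 4 ⊔ v 2 = v 1 ⊔ v 2 ∧ v 5 ⊓ v 2 = v 0 ∧ v 5 ⊓ v 3 = v 0 ∧
        v 5 ⊔ v 2 = v 2 ⊔ v 3 ∧ v 5 ⊔ v 3 = v 2 ⊔ v 3) ∧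
      ∀ i : σ, v (opVar i) ⊓ v 2 = v 0 ∧ v (opVar i) ⊔ v 2 = v 1 ⊔ v 2 := by
  simp only [LatConj.Sat, latConj, baseEqs, List.mem_append, or_imp, forall_and,
    List.forall_mem_map, List.mem_flatMap, Finset.mem_toList, Finset.mem_univ, true_and,
    forall_exists_index, latEq]
  refine and_congr Iff.rfl (and_congr ?_ ?_)
  · simp [frameEqs, LatTerm.eval]
  · rw [forall_comm]
    simp [graphEqs, LatTerm.eval, forall_and]

section Model

variable {F : Type*} [Field F] {W : Type*} [AddCommGroup W] [Module F W]

/-- The graph of `-f` in the first two coordinates. -/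
def graphAB (f : Module.End F W) : Submodule F (W × W × W) where
  carrier := {p | p.2.1 = -f p.1 ∧ p.2.2 = 0}
  add_mem' := by
    rintro a b ⟨h1, h2⟩ ⟨h3, h4⟩
    simp [h1, h2, h3, h4, add_comm]
  zero_mem' := by simp
  smul_mem' := by
    rintro c a ⟨h1, h2⟩
    simp [h1, h2]

/-- The graph of `-f` in the first and third coordinates. -/
def graphAC (f : Module.End F W) : Submodule F (W × W × W) where
  carrier := {p | p.2.2 = -f p.1 ∧ p.2.1 = 0}
  add_mem' := by
    rintro a b ⟨h1, h2⟩ ⟨h3, h4⟩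
    simp [h1, h2, h3, h4, add_comm]
  zero_mem' := by simp
  smul_mem' := by
    rintro c a ⟨h1, h2⟩
    simp [h1, h2]

/-- The graph of `-f` in the last two coordinates. -/
def graphBC (f : Module.End F W) : Submodule F (W × W × W) where
  carrier := {p | p.2.2 = -f p.2.1 ∧ p.1 = 0}
  add_mem' := by
    rintro a b ⟨h1, h2⟩ ⟨h3, h4⟩
    simp [h1, h2, h3, h4, add_comm]
  zero_mem' := by simp
  smul_mem' := by
    rintro c a ⟨h1, h2⟩
    simp [h1, h2]

/-- The second coordinate axis. -/
def axisB : Submodule F (W × W × W) := Submodule.prod ⊥ (Submodule.prod ⊤ ⊥)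

/-- The third coordinate axis. -/
def axisC : Submodule F (W × W × W) := Submodule.prod ⊥ (Submodule.prod ⊥ ⊤)

theorem mem_graphAB {f : Module.End F W} {x y z : W} :
    (x, y, z) ∈ graphAB f ↔ y = -f x ∧ z = 0 := Iff.rfl

theorem mem_graphAC {f : Module.End F W} {x y z : W} :
    (x, y, z) ∈ graphAC f ↔ z = -f x ∧ y = 0 := Iff.rfl

theorem mem_graphBC {f : Module.End F W} {x y z : W} :
    (x, y, z) ∈ graphBC f ↔ z = -f y ∧ x = 0 := Iff.rfl

theorem mem_axisB {x y z : W} : (x, y, z) ∈ (axisB : Submodule F (W × W × W)) ↔ x = 0 ∧ z = 0 := by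
  simp [axisB]

theorem mem_axisC {x y z : W} : (x, y, z) ∈ (axisC : Submodule F (W × W × W)) ↔ x = 0 ∧ y = 0 := by
  simp [axisC]

theorem mem_sup_triple {S T : Submodule F (W × W × W)} {x y z : W} :
    (x, y, z) ∈ S ⊔ T ↔ ∃ x' y' z', (x', y', z') ∈ S ∧ (x - x', y - y', z - z') ∈ T := by
  rw [Submodule.mem_sup]
  constructor
  · rintro ⟨⟨x', y', z'⟩, h1, ⟨x'', y'', z''⟩, h2, h3⟩
    simp only [Prod.mk_add_mk, Prod.mk.injEq] at h3
    obtain ⟨rfl, rfl, rfl⟩ := h3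
    exact ⟨x', y', z', h1, by simpa using h2⟩
  · rintro ⟨x', y', z', h1, h2⟩
    exact ⟨_, h1, _, h2, by simp⟩

theorem graphAB_injective : Function.Injective (graphAB : Module.End F W → _) := by
  intro f g h
  ext x
  have : (x, -f x, (0 : W)) ∈ graphAB g := h ▸ mem_graphAB.2 ⟨rfl, rfl⟩
  simpa using (mem_graphAB.1 this).1

theorem mem_planeAB {x y z : W} : (x, y, z) ∈ graphAB (0 : Module.End F W) ⊔ axisB ↔ z = 0 := by
  simp only [mem_sup_triple, mem_graphAB, mem_axisB]
  constructor
  · rintro ⟨x', y', z', ⟨-, rfl⟩, -, h⟩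
    simpa using h
  · rintro rfl
    exact ⟨x, 0, 0, by simp, by simp⟩

theorem mem_planeAC {x y z : W} : (x, y, z) ∈ graphAB (0 : Module.End F W) ⊔ axisC ↔ y = 0 := by
  simp only [mem_sup_triple, mem_graphAB, mem_axisC]
  constructor
  · rintro ⟨x', y', z', ⟨rfl, rfl⟩, -, h⟩
    simpa using h
  · rintro rfl
    exact ⟨x, 0, 0, by simp, by simp⟩

theorem mem_planeBC {x y z : W} :
    (x, y, z) ∈ (axisB : Submodule F (W × W × W)) ⊔ axisC ↔ x = 0 := by
  simp only [mem_sup_triple, mem_axisB, mem_axisC]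
  constructor
  · rintro ⟨x', y', z', ⟨rfl, rfl⟩, h, -⟩
    simpa using h
  · rintro rfl
    exact ⟨0, y, 0, by simp, by simp⟩

theorem graphAB_to_graphAC (f : Module.End F W) :
    (graphAB f ⊔ graphBC 1) ⊓ (graphAB (0 : Module.End F W) ⊔ axisC) = graphAC f := by
  ext ⟨x, y, z⟩
  rw [Submodule.mem_inf, mem_planeAC, mem_sup_triple]
  simp only [mem_graphAB, mem_graphBC, mem_graphAC, Module.End.one_apply]
  constructor
  · rintro ⟨⟨x', y', z', ⟨rfl, rfl⟩, h1, h2⟩, rfl⟩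
    obtain rfl := sub_eq_zero.1 h2
    simpa using h1
  · rintro ⟨rfl, rfl⟩
    exact ⟨⟨x, -f x, 0, by simp, by simp⟩, rfl⟩

theorem graphAC_to_graphAB (f : Module.End F W) :
    (graphAC f ⊔ graphBC 1) ⊓ (graphAB (0 : Module.End F W) ⊔ axisB) = graphAB f := by
  ext ⟨x, y, z⟩
  rw [Submodule.mem_inf, mem_planeAB, mem_sup_triple]
  simp only [mem_graphAB, mem_graphBC, mem_graphAC, Module.End.one_apply]
  constructor
  · rintro ⟨⟨x', y', z', ⟨rfl, rfl⟩, h1, h2⟩, rfl⟩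
    obtain rfl := sub_eq_zero.1 h2
    simp only [sub_neg_eq_add, zero_add, sub_zero] at h1
    exact ⟨by rw [h1, neg_neg], rfl⟩
  · rintro ⟨rfl, rfl⟩
    exact ⟨⟨x, 0, -f x, by simp, by simp⟩, rfl⟩

theorem graphAC_to_graphBC (f : Module.End F W) :
    (graphAB 1 ⊔ graphAC f) ⊓ ((axisB : Submodule F (W × W × W)) ⊔ axisC) = graphBC f := by
  ext ⟨x, y, z⟩
  rw [Submodule.mem_inf, mem_planeBC, mem_sup_triple]
  simp only [mem_graphAB, mem_graphBC, mem_graphAC, Module.End.one_apply]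
  constructor
  · rintro ⟨⟨x', y', z', ⟨rfl, rfl⟩, h1, h2⟩, rfl⟩
    simp only [sub_neg_eq_add, add_eq_zero_iff_eq_neg] at h2
    subst h2
    simpa using h1
  · rintro ⟨rfl, rfl⟩
    exact ⟨⟨-y, y, 0, by simp, by simp⟩, rfl⟩

theorem graph_mul (f g : Module.End F W) :
    (graphAB g ⊔ graphBC f) ⊓ (graphAB (0 : Module.End F W) ⊔ axisC) = graphAC (f * g) := by
  ext ⟨x, y, z⟩
  rw [Submodule.mem_inf, mem_planeAC, mem_sup_triple]
  simp only [mem_graphAB, mem_graphBC, mem_graphAC, Module.End.mul_apply]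
  constructor
  · rintro ⟨⟨x', y', z', ⟨rfl, rfl⟩, h1, h2⟩, rfl⟩
    obtain rfl := sub_eq_zero.1 h2
    simpa using h1
  · rintro ⟨rfl, rfl⟩
    exact ⟨⟨x, -g x, 0, by simp, by simp⟩, rfl⟩

theorem graph_add (f g : Module.End F W) :
    ((graphAB f ⊔ axisC) ⊓ (graphAC g ⊔ axisB) ⊔ graphBC 1) ⊓
      (graphAB (0 : Module.End F W) ⊔ axisB) = graphAB (f + g) := by
  have hf : ∀ x y z : W, (x, y, z) ∈ graphAB f ⊔ axisC ↔ y = -f x := by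
    intro x y z
    simp only [mem_sup_triple, mem_graphAB, mem_axisC]
    constructor
    · rintro ⟨x', y', z', ⟨rfl, rfl⟩, h1, h2⟩
      obtain rfl := sub_eq_zero.1 h1
      exact sub_eq_zero.1 h2
    · rintro rfl
      exact ⟨x, -f x, 0, by simp, by simp⟩
  have hg : ∀ x y z : W, (x, y, z) ∈ graphAC g ⊔ axisB ↔ z = -g x := by
    intro x y z
    simp only [mem_sup_triple, mem_graphAC, mem_axisB]
    constructor
    · rintro ⟨x', y', z', ⟨rfl, rfl⟩, h1, h2⟩
      obtain rfl := sub_eq_zero.1 h1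
      exact sub_eq_zero.1 h2
    · rintro rfl
      exact ⟨x, 0, -g x, by simp, by simp⟩
  ext ⟨x, y, z⟩
  rw [Submodule.mem_inf, mem_planeAB, mem_sup_triple]
  simp only [Submodule.mem_inf, hf, hg, mem_graphAB, mem_graphBC, Module.End.one_apply,
    LinearMap.add_apply]
  constructor
  · rintro ⟨⟨x', y', z', ⟨rfl, rfl⟩, h1, h2⟩, rfl⟩
    obtain rfl := sub_eq_zero.1 h2
    refine ⟨?_, rfl⟩
    simp only [sub_neg_eq_add, zero_add] at h1
    rw [h1]; abel
  · rintro ⟨rfl, rfl⟩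
    exact ⟨⟨x, -f x, -g x, by simp, by simp⟩, rfl⟩

/-- The coordinate frame of `W × W × W` together with the graphs of the operators `ρ i`. -/
structure IsCoord {σ : Type} [Encodable σ] (ρ : σ → Module.End F W)
    (u : ℕ → Submodule F (W × W × W)) : Prop where
  bot : u 0 = ⊥
  axisA : u 1 = graphAB 0
  axisB : u 2 = axisB
  axisC : u 3 = axisC
  diagAB : u 4 = graphAB 1
  diagBC : u 5 = graphBC 1
  op : ∀ i, u (opVar i) = graphAB (ρ i)

variable {σ : Type} [Encodable σ] {ρ : σ → Module.End F W} {u : ℕ → Submodule F (W × W × W)}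

theorem IsCoord.eval_latTerm (hu : IsCoord ρ u) (t : RingTerm σ) :
    (latTerm t).eval u = graphAB (t.eval ρ) := by
  induction t with
  | var i => exact hu.op i
  | zero => exact hu.axisA
  | one => exact hu.diagAB
  | add s t hs ht =>
    simp only [latTerm, addTerm, toAC, toAB, LatTerm.eval, hs, ht, hu.axisA, hu.axisB, hu.axisC,
      hu.diagBC, graphAB_to_graphAC, graph_add, RingTerm.eval]
  | mul s t hs ht =>
    simp only [latTerm, mulTerm, toAC, toAB, toBC, LatTerm.eval, hs, ht, hu.axisA, hu.axisB,
      hu.axisC, hu.diagAB, hu.diagBC, graphAC_to_graphBC, graph_mul, one_mul,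
      graphAC_to_graphAB, RingTerm.eval]

theorem graphAB_inf_axisB (f : Module.End F W) : graphAB f ⊓ axisB = ⊥ := by
  ext ⟨x, y, z⟩
  simp only [Submodule.mem_inf, mem_graphAB, mem_axisB, Submodule.mem_bot, Prod.mk_eq_zero]
  constructor
  · rintro ⟨⟨rfl, rfl⟩, rfl, -⟩
    simp
  · rintro ⟨rfl, rfl, rfl⟩
    simp

theorem graphAB_sup_axisB (f : Module.End F W) :
    graphAB f ⊔ axisB = graphAB (0 : Module.End F W) ⊔ axisB := by
  ext ⟨x, y, z⟩
  rw [mem_planeAB]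
  simp only [mem_sup_triple, mem_graphAB, mem_axisB]
  constructor
  · rintro ⟨x', y', z', ⟨-, rfl⟩, -, h⟩
    simpa using h
  · rintro rfl
    exact ⟨x, -f x, 0, by simp, by simp⟩

theorem IsCoord.sat [Fintype σ] (hu : IsCoord ρ u) {E : List (RingTerm σ × RingTerm σ)}
    (hE : ∀ p ∈ E, p.1.eval ρ = p.2.eval ρ) : (latConj E).Sat u := by
  rw [sat_iff]
  refine ⟨fun p hp => ?_, ?_, fun i => ?_⟩
  · rw [hu.eval_latTerm, hu.eval_latTerm, hE p hp]
  · simp only [hu.bot, hu.axisA, hu.axisB, hu.axisC, hu.diagAB, hu.diagBC, graphAB_inf_axisB,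
      graphAB_sup_axisB, true_and, ← SetLike.coe_set_eq]
    refine ⟨?_, ?_, ?_, ?_, ?_, ?_, ?_⟩ <;> ext ⟨x, y, z⟩ <;>
      simp only [SetLike.mem_coe, Submodule.mem_inf, mem_planeAB, mem_planeBC] <;>
      simp only [mem_graphAB, mem_graphBC, mem_axisB, mem_axisC, Submodule.mem_bot,
        Prod.mk_eq_zero, Module.End.one_apply, LinearMap.zero_apply, neg_zero, mem_sup_triple]
    · tauto
    · constructor
      · rintro ⟨⟨rfl, rfl⟩, h, -⟩
        simpa using h
      · rintro ⟨rfl, rfl, rfl⟩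
        simp
    · constructor
      · rintro ⟨x', y', z', ⟨rfl, rfl⟩, h⟩
        simpa using h.2
      · rintro rfl
        exact ⟨-y, y, 0, by simp, by simp⟩
    · constructor
      · rintro ⟨⟨rfl, rfl⟩, -, h⟩
        simpa using h
      · rintro ⟨rfl, rfl, rfl⟩
        simp
    · constructor
      · rintro ⟨⟨rfl, rfl⟩, -, rfl⟩
        simp
      · rintro ⟨rfl, rfl, rfl⟩
        simp
    · constructor
      · rintro ⟨x', y', z', ⟨rfl, rfl⟩, h⟩
        simpa using h.1
      · rintro rfl
        exact ⟨0, -z, z, by simp, by simp⟩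
    · constructor
      · rintro ⟨x', y', z', ⟨rfl, rfl⟩, h⟩
        simpa using h.1
      · rintro rfl
        exact ⟨0, y, -y, by simp, by simp⟩
  · rw [hu.op, hu.axisB, hu.bot, hu.axisA]
    exact ⟨graphAB_inf_axisB _, graphAB_sup_axisB _⟩

end Model

theorem zero_mem_vars {σ : Type} [Encodable σ] [Fintype σ] (E : List (RingTerm σ × RingTerm σ)) :
    0 ∈ (latConj E).vars ∧ 1 ∈ (latConj E).vars := by
  have h : (LatTerm.inf (.var 1) (.var 2), LatTerm.var 0) ∈ latConj E := by
    simp [latConj, baseEqs, frameEqs]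
  exact ⟨(mem_vars_iff _ _).2 ⟨_, h, Or.inr (by simp [LatTerm.vars])⟩,
    (mem_vars_iff _ _).2 ⟨_, h, Or.inl (by simp [LatTerm.vars])⟩⟩

/-- A finite-dimensional solution of a system of ring equations yields a non-trivial solution of
its lattice equations. -/
theorem exists_sat_of_model {F : Type*} [Field F] {σ : Type} [Encodable σ] [Fintype σ]
    {E : List (RingTerm σ × RingTerm σ)} {W : Type*} [AddCommGroup W] [Module F W]
    [FiniteDimensional F W] [Nontrivial W] (ρ : σ → Module.End F W)
    (hE : ∀ p ∈ E, p.1.eval ρ = p.2.eval ρ) :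
    ∃ d : ℕ, 1 ≤ d ∧ ∃ v : ℕ → Submodule F (Fin d → F),
      (latConj E).Sat v ∧ (latConj E).Nontriv v := by
  classical
  let u : ℕ → Submodule F (W × W × W) := fun k =>
    match k with
    | 0 => ⊥
    | 1 => graphAB 0
    | 2 => axisB
    | 3 => axisC
    | 4 => graphAB 1
    | 5 => graphBC 1
    | k + 6 => match (Encodable.decode k : Option σ) with
      | some i => graphAB (ρ i)
      | none => ⊥
  have hu : IsCoord ρ u :=
    ⟨rfl, rfl, rfl, rfl, rfl, rfl, fun i => by simp only [u, opVar, Encodable.encodek]⟩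
  let d := Module.finrank F (W × W × W)
  let e : (W × W × W) ≃ₗ[F] (Fin d → F) := LinearEquiv.ofFinrankEq _ _ (by simp [d])
  have hinj : Function.Injective (Submodule.map e.toLinearMap) :=
    Submodule.map_injective_of_injective e.injective
  refine ⟨d, Module.finrank_pos, fun k => (u k).map e.toLinearMap, ?_, ?_⟩
  · refine sat_partialHom (Submodule.map e.toLinearMap) (fun _ => True)
      (fun x y _ _ => ⟨trivial, Submodule.map_sup _ _ _⟩)
      (fun x y _ _ => ⟨trivial, Submodule.map_inf _ e.injective⟩) (fun _ _ => trivial) (hu.sat hE)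
  · refine ⟨0, (zero_mem_vars E).1, 1, (zero_mem_vars E).2, fun h => ?_⟩
    have h := hinj h
    obtain ⟨x, hx⟩ := exists_ne (0 : W)
    have : (x, (0 : W), (0 : W)) ∈ u 0 := by
      rw [h]; exact mem_graphAB.2 (by simp)
    rw [hu.bot] at this
    simp at this
    exact hx this

section Frame

variable {F : Type*} [Field F] {V : Type*} [AddCommGroup V] [Module F V]

theorem exists_linearMap_of_graph {A B P : Submodule F V} (hPB : P ⊓ B = ⊥) (hA : A ≤ P ⊔ B) :
    ∃ f : A →ₗ[F] B, ∀ x : A, (x : V) - f x ∈ P := by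
  have key : ∀ y : V, y ∈ P → y ∈ B → y = 0 := fun y h1 h2 => by
    have : y ∈ P ⊓ B := ⟨h1, h2⟩
    simpa [hPB] using this
  have hex : ∀ x : A, ∃ y : B, (x : V) - y ∈ P := fun x => by
    obtain ⟨p, hp, b, hb, h⟩ := Submodule.mem_sup.1 (hA x.2)
    exact ⟨⟨b, hb⟩, by rw [← h]; simpa using hp⟩
  choose f hf using hex
  refine ⟨{ toFun := f, map_add' := fun x y => ?_, map_smul' := fun c x => ?_ }, hf⟩
  · refine Subtype.ext (sub_eq_zero.1 (key _ ?_ ?_))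
    · have h := P.sub_mem (P.add_mem (hf x) (hf y)) (hf (x + y))
      convert h using 1
      push_cast
      abel
    · exact B.sub_mem (f (x + y)).2 (f x + f y).2
  · refine Subtype.ext (sub_eq_zero.1 (key _ ?_ ?_))
    · have h := P.sub_mem (P.smul_mem c (hf x)) (hf (c • x))
      convert h using 1
      simp only [RingHom.id_apply, Submodule.coe_smul, smul_sub]
      abel
    · exact B.sub_mem (f (c • x)).2 (c • f x).2

theorem comap_sup_of_le_range {W : Type*} [AddCommGroup W] [Module F W] (J : W →ₗ[F] V)
    {X Y : Submodule F V} (hX : X ≤ LinearMap.range J) :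
    (X ⊔ Y).comap J = X.comap J ⊔ Y.comap J := by
  refine le_antisymm (fun w hw => ?_) (sup_le (Submodule.comap_mono le_sup_left)
    (Submodule.comap_mono le_sup_right))
  obtain ⟨x, hx, y, hy, h⟩ := Submodule.mem_sup.1 (Submodule.mem_comap.1 hw)
  obtain ⟨a, rfl⟩ := hX hx
  have : w = a + (w - a) := by abel
  rw [this]
  refine Submodule.add_mem_sup hx ?_
  have hy' : J (w - a) = y := by rw [map_sub, ← h]; abel
  exact Submodule.mem_comap.2 (hy' ▸ hy)

/-- Coordinatization: a solution of the lattice equations with zero bottom element yields operators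
on the first subspace of the frame solving the ring equations. -/
theorem model_of_sat_bot {σ : Type} [Encodable σ] [Fintype σ] {E : List (RingTerm σ × RingTerm σ)}
    {v : ℕ → Submodule F V} (hv : (latConj E).Sat v) (h0 : v 0 = ⊥) :
    ∃ ρ : σ → Module.End F (v 1), ∀ p ∈ E, p.1.eval ρ = p.2.eval ρ := by
  obtain ⟨-, ⟨hAB, hABC, hPA, hPB, hPsA, hPsB, hQB, hQC, hQsB, hQsC⟩, hop⟩ := sat_iff.1 hv
  rw [h0] at hAB hABC hPA hPB hQB hQC
  have disj : ∀ {S T : Submodule F V}, S ⊓ T = ⊥ → ∀ {y : V}, y ∈ S → y ∈ T → y = 0 :=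
    fun {S T} h {y} h1 h2 => by
      have : y ∈ S ⊓ T := ⟨h1, h2⟩
      simpa [h] using this
  obtain ⟨φ, hφ⟩ := exists_linearMap_of_graph (A := v 1) hPB (hPsB ▸ le_sup_left)
  obtain ⟨φ', hφ'⟩ := exists_linearMap_of_graph (A := v 2) hPA (hPsA ▸ le_sup_right)
  obtain ⟨θ, hθ⟩ := exists_linearMap_of_graph (A := v 2) hQC (hQsC ▸ le_sup_left)
  obtain ⟨θ', hθ'⟩ := exists_linearMap_of_graph (A := v 3) hQB (hQsB ▸ le_sup_right)
  have hφφ' : ∀ y, φ (φ' y) = y := fun y => by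
    refine Subtype.ext (sub_eq_zero.1 (disj hPB ?_ ((v 2).sub_mem (φ (φ' y)).2 y.2)))
    have h := (v 4).neg_mem ((v 4).add_mem (hφ' y) (hφ (φ' y)))
    convert h using 1
    abel
  have hθθ' : ∀ y, θ (θ' y) = y := fun y => by
    refine Subtype.ext (sub_eq_zero.1 (disj hQC ?_ ((v 3).sub_mem (θ (θ' y)).2 y.2)))
    have h := (v 5).neg_mem ((v 5).add_mem (hθ' y) (hθ (θ' y)))
    convert h using 1
    abel
  have hφ0 : ∀ x, (φ x : V) = 0 → x = 0 := fun x hx => by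
    have h := hφ x
    rw [hx, sub_zero] at h
    exact Subtype.ext (disj hPA h x.2)
  have hθ0 : ∀ x, (θ x : V) = 0 → x = 0 := fun x hx => by
    have h := hθ x
    rw [hx, sub_zero] at h
    exact Subtype.ext (disj hQB h x.2)
  let J : (v 1 × v 1 × v 1) →ₗ[F] V :=
    (v 1).subtype.coprod (((v 2).subtype ∘ₗ φ).coprod ((v 3).subtype ∘ₗ θ ∘ₗ φ))
  have hJ : ∀ x y z, J (x, y, z) = x + (φ y + θ (φ z)) := fun x y z => rfl
  have hJA : v 1 ≤ LinearMap.range J := fun x hx => ⟨(⟨x, hx⟩, 0, 0), by simp [hJ]⟩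
  have hJB : v 2 ≤ LinearMap.range J := fun x hx =>
    ⟨(0, φ' ⟨x, hx⟩, 0), by simp [hJ, hφφ']⟩
  have hJC : v 3 ≤ LinearMap.range J := fun x hx =>
    ⟨(0, 0, φ' (θ' ⟨x, hx⟩)), by simp [hJ, hφφ', hθθ']⟩
  have mA : ∀ x : v 1, (x : V) ∈ v 1 ⊔ v 2 := fun x => Submodule.mem_sup_left x.2
  have mB : ∀ x : v 2, (x : V) ∈ v 1 ⊔ v 2 := fun x => Submodule.mem_sup_right x.2
  have third : ∀ x y z, J (x, y, z) ∈ v 1 ⊔ v 2 → z = 0 := fun x y z h => by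
    rw [hJ, ← add_assoc] at h
    have h' := (Submodule.add_mem_iff_right _ (Submodule.add_mem _ (mA x) (mB (φ y)))).1 h
    have := hθ0 _ (disj hABC h' (θ (φ z)).2)
    exact hφ0 z (by rw [this]; rfl)
  have first : ∀ x y z, J (x, y, z) ∈ v 2 ⊔ v 3 → x = 0 := fun x y z h => by
    have h' : (x : V) ∈ v 2 ⊔ v 3 := by
      rw [hJ] at h
      exact (Submodule.add_mem_iff_left _ (Submodule.add_mem _
        (Submodule.mem_sup_left (φ y).2) (Submodule.mem_sup_right (θ (φ z)).2))).1 h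
    obtain ⟨b, hb, c, hc, hbc⟩ := Submodule.mem_sup.1 h'
    have hc' : c ∈ v 1 ⊔ v 2 := by
      have : c = x - b := by rw [← hbc]; abel
      rw [this]
      exact Submodule.sub_mem _ (mA x) (Submodule.mem_sup_right hb)
    have hc0 := disj hABC hc' hc
    rw [hc0, add_zero] at hbc
    exact Subtype.ext (disj hAB x.2 (hbc ▸ hb))
  have graph : ∀ X : Submodule F V, X ⊓ v 2 = ⊥ → X ⊔ v 2 = v 1 ⊔ v 2 →
      ∀ f : v 1 →ₗ[F] v 2, (∀ x : v 1, (x : V) - f x ∈ X) → X.comap J = graphAB (φ' ∘ₗ f) := by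
    intro X h1 h2 f hf
    ext ⟨x, y, z⟩
    rw [Submodule.mem_comap, mem_graphAB]
    constructor
    · intro h
      obtain rfl := third x y z (h2 ▸ Submodule.mem_sup_left h)
      refine ⟨eq_neg_of_add_eq_zero_left (hφ0 _ (disj h1 ?_ (Subtype.coe_prop _))), rfl⟩
      have h' := X.sub_mem h (hf x)
      convert h' using 1
      rw [hJ]
      simp only [map_add, map_zero, LinearMap.comp_apply, hφφ', Submodule.coe_add,
        Submodule.coe_zero]
      abel
    · rintro ⟨rfl, rfl⟩
      rw [hJ]
      simpa [hφφ', sub_eq_add_neg] using hf x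
  have hex : ∀ i : σ, ∃ f : v 1 →ₗ[F] v 2, ∀ x : v 1, (x : V) - f x ∈ v (opVar i) := fun i =>
    exists_linearMap_of_graph (by rw [(hop i).1, h0]) (le_sup_left.trans (hop i).2.ge)
  choose f hf using hex
  have hone : φ' ∘ₗ φ = (1 : Module.End F (v 1)) := by
    ext1 x
    have : φ (φ' (φ x) - x) = 0 := by rw [map_sub, hφφ', sub_self]
    exact sub_eq_zero.1 (hφ0 (φ' (φ x) - x) (by rw [this]; rfl))
  have hu : IsCoord (fun i => φ' ∘ₗ f i) (fun k => (v k).comap J) := by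
    refine ⟨?_, ?_, ?_, ?_, ?_, ?_, fun i => ?_⟩
    · rw [h0]
      refine eq_bot_iff.2 ?_
      rintro ⟨x, y, z⟩ h
      have h : J (x, y, z) = 0 := by simpa using h
      obtain rfl := third x y z (h ▸ Submodule.zero_mem _)
      obtain rfl := first x y 0 (h ▸ Submodule.zero_mem _)
      have : y = 0 := hφ0 y (by simpa [hJ] using h)
      simp [this]
    · have := graph (v 1) hAB rfl 0 (fun x => by simp)
      simpa using this
    · ext ⟨x, y, z⟩
      rw [Submodule.mem_comap, mem_axisB]
      refine ⟨fun h => ⟨first x y z (Submodule.mem_sup_left h),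
        third x y z (Submodule.mem_sup_right h)⟩, ?_⟩
      rintro ⟨rfl, rfl⟩
      simp [hJ]
    · ext ⟨x, y, z⟩
      rw [Submodule.mem_comap, mem_axisC]
      constructor
      · intro h
        obtain rfl := first x y z (Submodule.mem_sup_right h)
        refine ⟨rfl, hφ0 y (disj hABC (mB (φ y)) ?_)⟩
        rw [hJ, Submodule.coe_zero, zero_add] at h
        exact (Submodule.add_mem_iff_left _ (θ (φ z)).2).1 h
      · rintro ⟨rfl, rfl⟩
        simp [hJ]
    · rw [graph (v 4) hPB hPsB φ hφ, hone]
    · ext ⟨x, y, z⟩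
      rw [Submodule.mem_comap, mem_graphBC]
      constructor
      · intro h
        obtain rfl := first x y z (hQsB ▸ Submodule.mem_sup_left h)
        refine ⟨eq_neg_of_add_eq_zero_left (hφ0 _ ?_), rfl⟩
        have : φ (z + y) = 0 := by
          refine hθ0 _ (disj hQC ?_ (Subtype.coe_prop _))
          have h' := (v 5).sub_mem h (hθ (φ y))
          convert h' using 1
          rw [hJ]
          simp only [map_add, Submodule.coe_add, Submodule.coe_zero]
          abel
        rw [Module.End.one_apply, this]; rfl
      · rintro ⟨rfl, rfl⟩
        rw [hJ]
        simpa [sub_eq_add_neg] using hθ (φ y)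
    · exact graph _ (by rw [(hop i).1, h0]) (hop i).2 (f i) (hf i)
  have hgood : ∀ k, Used σ k → v k ≤ LinearMap.range J := by
    rintro k (hk | ⟨i, rfl⟩)
    · interval_cases k
      · rw [h0]; exact bot_le
      · exact hJA
      · exact hJB
      · exact hJC
      · exact le_sup_left.trans (hPsB.trans_le (sup_le hJA hJB))
      · exact le_sup_left.trans (hQsB.trans_le (sup_le hJB hJC))
    · exact le_sup_left.trans ((hop i).2.trans_le (sup_le hJA hJB))
  have hsat := sat_partialHom (Submodule.comap J) (fun X => X ≤ LinearMap.range J)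
    (fun x y hx hy => ⟨sup_le hx hy, comap_sup_of_le_range J hx⟩)
    (fun x y hx _ => ⟨inf_le_left.trans hx, Submodule.comap_inf x y J⟩) hgood hv
  refine ⟨fun i => φ' ∘ₗ f i, fun p hp => graphAB_injective ?_⟩
  rw [← hu.eval_latTerm, ← hu.eval_latTerm]
  exact (sat_iff.1 hsat).1 p hp

theorem map_mkQ_inf {Z X Y : Submodule F V} (hX : Z ≤ X) :
    (X ⊓ Y).map Z.mkQ = X.map Z.mkQ ⊓ Y.map Z.mkQ := by
  refine le_antisymm (Submodule.map_inf_le _) ?_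
  rintro _ ⟨⟨x, hx, rfl⟩, ⟨y, hy, hxy⟩⟩
  have h : y - x ∈ Z := (Submodule.Quotient.eq Z).1 hxy
  have hyx : y ∈ X := by simpa using X.add_mem (hX h) hx
  exact ⟨y, ⟨hyx, hy⟩, hxy⟩

theorem eq_of_axis_eq_bot {σ : Type} [Encodable σ] [Fintype σ]
    {E : List (RingTerm σ × RingTerm σ)} {L : Type*} [Lattice L] {v : ℕ → L}
    (hv : (latConj E).Sat v) : (∀ k, Used σ k → v 0 ≤ v k) ∧
      (v 1 = v 0 → ∀ k, Used σ k → v k = v 0) := by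
  obtain ⟨-, ⟨hAB, hABC, hPA, hPB, hPsA, hPsB, hQB, hQC, hQsB, hQsC⟩, hop⟩ := sat_iff.1 hv
  have h1 : v 0 ≤ v 1 := hAB ▸ inf_le_left
  have h2 : v 0 ≤ v 2 := hAB ▸ inf_le_right
  have h3 : v 0 ≤ v 3 := hABC ▸ inf_le_right
  have h4 : v 0 ≤ v 4 := hPA ▸ inf_le_left
  have h5 : v 0 ≤ v 5 := hQB ▸ inf_le_left
  have hi : ∀ i : σ, v 0 ≤ v (opVar i) := fun i => (hop i).1.ge.trans inf_le_left
  constructor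
  · rintro k (hk | ⟨i, rfl⟩)
    · interval_cases k <;> first | assumption | exact le_rfl
    · exact hi i
  · intro h
    rw [h, sup_eq_left.2 h4, sup_eq_right.2 h2] at hPsA
    rw [hPsA, inf_idem] at hPB
    rw [hPB, sup_eq_left.2 h5, sup_eq_right.2 h3] at hQsB
    rw [hQsB, inf_idem] at hQC
    rintro k (hk | ⟨i, rfl⟩)
    · interval_cases k
      · rfl
      · exact h
      · exact hPB
      · exact hQC
      · rw [hPsA, hPB]
      · rw [hQsB, hQC]
    · have := (hop i).2
      rwa [h, hPB, sup_idem, sup_eq_left.2 (hi i)] at this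

/-- A non-trivial solution of the lattice equations yields a finite-dimensional solution of the ring
equations. -/
theorem exists_model_of_sat {σ : Type} [Encodable σ] [Fintype σ]
    {E : List (RingTerm σ × RingTerm σ)} {v : ℕ → Submodule F V}
    (hv : (latConj E).Sat v) (hn : (latConj E).Nontriv v) :
    ∃ (Z : Submodule F V) (W : Submodule F (V ⧸ Z)) (_ : Nontrivial W)
      (ρ : σ → Module.End F W), ∀ p ∈ E, p.1.eval ρ = p.2.eval ρ := by
  obtain ⟨hge, heq⟩ := eq_of_axis_eq_bot hv
  have hsat := sat_partialHom (Submodule.map (v 0).mkQ) (fun X => v 0 ≤ X)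
    (fun x y hx _ => ⟨hx.trans le_sup_left, Submodule.map_sup _ _ _⟩)
    (fun x y hx hy => ⟨le_inf hx hy, map_mkQ_inf hx⟩) hge hv
  obtain ⟨ρ, hρ⟩ := model_of_sat_bot hsat (by
    rw [← Submodule.mkQ_map_self (v 0)])
  refine ⟨v 0, (v 1).map (v 0).mkQ, ?_, ρ, hρ⟩
  rw [Submodule.nontrivial_iff_ne_bot]
  intro hbot
  have h1 : v 1 = v 0 := le_antisymm (by
    simpa using (Submodule.map_le_iff_le_comap).1 hbot.le) (hge 1 (Or.inl (by norm_num)))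
  obtain ⟨i, hi, j, hj, hij⟩ := hn
  obtain ⟨p, hp, hip⟩ := (mem_vars_iff _ _).1 hi
  obtain ⟨q, hq, hjq⟩ := (mem_vars_iff _ _).1 hj
  exact hij ((heq h1 i (used_of_mem_vars E hp hip)).trans
    (heq h1 j (used_of_mem_vars E hq hjq)).symm)

end Frame

end Coord

/-! ### From nondeterministic register machines to ring equations -/

/-- A guarded command of a register machine with registers `0, …, M`: if the two polynomials in
`guard` agree at the current state, the registers may be updated simultaneously by `upd`. -/
structure MachineRule (M : ℕ) where
  /-- The two polynomials that have to agree. -/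
  guard : RingTerm (Fin (M + 1)) × RingTerm (Fin (M + 1))
  /-- The new values of the registers. -/
  upd : Fin (M + 1) → RingTerm (Fin (M + 1))

/-- One step by a rule. -/
def MachineRule.Step {M : ℕ} (r : MachineRule M) (x y : Fin (M + 1) → ℕ) : Prop :=
  r.guard.1.eval x = r.guard.2.eval x ∧ y = fun j => (r.upd j).eval x

namespace Machine

variable {M k : ℕ} (P : Fin k → MachineRule M) (init : Fin (M + 1) → RingTerm Unit)

/-- One step of a register machine. -/
def Step (x y : Fin (M + 1) → ℕ) : Prop := ∃ i, (P i).Step x y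

/-- Some run from `x` empties register `0`. -/
def Accepts (x : Fin (M + 1) → ℕ) : Prop := ∃ y, Relation.ReflTransGen (Step P) x y ∧ y 0 = 0

/-- Names of the linear operators describing a run: six auxiliary operators, the registers, and
for each rule the operators applying and undoing it. -/
abbrev Op (M k : ℕ) : Type := Fin 6 ⊕ Fin (M + 1) ⊕ Fin k ⊕ Fin k

/-- The name of an auxiliary operator. -/
abbrev aux (i : Fin 6) : Op M k := Sum.inl i

/-- The name of a register. -/
abbrev reg (j : Fin (M + 1)) : Op M k := Sum.inr (Sum.inl j)

/-- The name of the operator applying a rule. -/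
abbrev fwd (i : Fin k) : Op M k := Sum.inr (Sum.inr (Sum.inl i))

/-- The name of the operator undoing a rule. -/
abbrev bwd (i : Fin k) : Op M k := Sum.inr (Sum.inr (Sum.inr i))

open RingTerm

/-- The ring equations describing an accepting run. The auxiliary operators `0, …, 5` are a clock,
the projections to the initial and to the final state, the shift, its left inverse away
from the initial state, and the input. -/
def fixedEqs : List (RingTerm (Op M k) × RingTerm (Op M k)) :=
  [(add (mul (var (aux 4)) (var (aux 3))) (var (aux 1)), one),
   (add (mul (var (aux 0)) (var (aux 3))) (var (aux 3)), mul (var (aux 3)) (var (aux 0))),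
   (mul (var (aux 0)) (var (aux 1)), zero),
   (add (var (aux 2)) ((List.finRange k).foldr
      (fun i t => add (mul (var (bwd i)) (var (fwd i))) t) zero), one),
   (mul (var (aux 2)) (var (reg 0)), zero)] ++
  ((List.finRange (M + 1)).map fun j =>
    (mul (var (reg j)) (var (aux 1)),
      mul ((init j).rename fun _ => aux 5) (var (aux 1)))) ++
  ((List.finRange k).map fun i =>
    (mul (var (fwd i)) ((P i).guard.1.rename reg), mul (var (fwd i)) ((P i).guard.2.rename reg))) ++
  ((List.finRange k).map fun i =>
    (mul (var (aux 0)) (var (fwd i)),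
      add (mul (var (fwd i)) (var (aux 0))) (var (fwd i)))) ++
  (List.finRange k).flatMap fun i => (List.finRange (M + 1)).map fun j =>
    (mul (var (reg j)) (var (fwd i)), mul (var (fwd i)) (((P i).upd j).rename reg))

/-- The ring equations describing an accepting run on input `n`. -/
def eqs (n : ℕ) : List (RingTerm (Op M k) × RingTerm (Op M k)) :=
  (var (aux 5), num n) :: fixedEqs P init

theorem eval_foldr_add {σ α : Type} {R : Type*} [Semiring R] (ρ : σ → R) (l : List α)
    (t : α → RingTerm σ) :
    (l.foldr (fun i s => add (t i) s) zero).eval ρ = (l.map fun i => (t i).eval ρ).sum := by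
  induction l with
  | nil => rfl
  | cons a l ih => simp [eval, ih]

theorem forall_mem_eqs_iff {R : Type*} [Semiring R] (ρ : Op M k → R) (n : ℕ) :
    (∀ p ∈ eqs P init n, p.1.eval ρ = p.2.eval ρ) ↔
      ρ (aux 5) = n ∧ ρ (aux 4) * ρ (aux 3) + ρ (aux 1) = 1 ∧
      ρ (aux 0) * ρ (aux 3) + ρ (aux 3) = ρ (aux 3) * ρ (aux 0) ∧
      ρ (aux 0) * ρ (aux 1) = 0 ∧
      ρ (aux 2) + ∑ i, ρ (bwd i) * ρ (fwd i) = 1 ∧ ρ (aux 2) * ρ (reg 0) = 0 ∧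
      (∀ j, ρ (reg j) * ρ (aux 1) = (init j).eval (fun _ => ρ (aux 5)) * ρ (aux 1)) ∧
      (∀ i, ρ (fwd i) * (P i).guard.1.eval (fun j => ρ (reg j)) =
        ρ (fwd i) * (P i).guard.2.eval (fun j => ρ (reg j))) ∧
      (∀ i, ρ (aux 0) * ρ (fwd i) = ρ (fwd i) * ρ (aux 0) + ρ (fwd i)) ∧
      ∀ i j, ρ (reg j) * ρ (fwd i) = ρ (fwd i) * ((P i).upd j).eval (fun j => ρ (reg j)) := by
  simp only [eqs, fixedEqs, List.mem_cons, List.mem_append, or_imp, forall_and, forall_eq,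
    List.mem_flatMap, List.forall_mem_map, List.mem_finRange, true_and, forall_true_left, eval,
    eval_num, eval_rename, eval_foldr_add, List.not_mem_nil, false_imp_iff, and_true,
    forall_exists_index, and_assoc, Fin.sum_univ_def]
  rw [forall_comm]
  simp [eval, eval_rename]

section Soundness

variable {F : Type*} [Field F] {W : Type*} [AddCommGroup W] [Module F W]

theorem eval_apply_eigenvector {σ : Type} {ρ : σ → Module.End F W} {x : σ → ℕ} {w : W}
    (h : ∀ i, ρ i w = (x i : F) • w) (t : RingTerm σ) :
    t.eval ρ w = ((t.eval x : ℕ) : F) • w := by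
  induction t with
  | var i => exact h i
  | zero => simp [eval]
  | one => simp [eval]
  | add s t hs ht => simp [eval, hs, ht, add_smul]
  | mul s t hs ht => simp [eval, hs, ht, smul_smul, mul_comm]

variable {P init} in
/-- A finite-dimensional solution of the equations yields an accepting run. -/
theorem accepts_of_model [CharZero F] [FiniteDimensional F W] [Nontrivial W] {n : ℕ}
    {ρ : Op M k → Module.End F W} (hρ : ∀ p ∈ eqs P init n, p.1.eval ρ = p.2.eval ρ) :
    Accepts P fun j => (init j).eval fun _ => n := by
  obtain ⟨hn, hLR, hcR, hce, hT, hh, hinit, hguard, hcS, hupd⟩ := (forall_mem_eqs_iff _ _ _ _).1 hρ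
  by_contra hacc
  have he : ρ (aux 1) ≠ 0 := by
    intro he
    rw [he, add_zero] at hLR
    have hRL := mul_eq_one_comm.1 hLR
    have h := congrArg (ρ (aux 4) * ·) hcR
    simp only [mul_add, hLR, ← mul_assoc, one_mul] at h
    have htr := congrArg (LinearMap.trace F W) h
    rw [map_add, LinearMap.trace_mul_comm, ← mul_assoc, hRL, one_mul, LinearMap.trace_one,
      add_eq_left, Nat.cast_eq_zero] at htr
    exact Module.finrank_pos.ne' htr
  obtain ⟨u, hu⟩ : ∃ u, ρ (aux 1) u ≠ 0 := by
    by_contra! h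
    exact he (LinearMap.ext h)
  have key : ∀ t : ℕ, ∃ x w, Relation.ReflTransGen (Step P) (fun j => (init j).eval fun _ => n) x ∧
      w ≠ 0 ∧ ρ (aux 0) w = (t : F) • w ∧ ∀ j, ρ (reg j) w = (x j : F) • w := by
    intro t
    induction t with
    | zero =>
      refine ⟨_, _, .refl, hu, ?_, fun j => ?_⟩
      · simpa using LinearMap.congr_fun hce u
      · refine (LinearMap.congr_fun (hinit j) u).trans ?_
        rw [Module.End.mul_apply]
        refine eval_apply_eigenvector (fun _ => ?_) _
        rw [hn]
        simp [Module.End.natCast_apply, Nat.cast_smul_eq_nsmul]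
    | succ t ih =>
      obtain ⟨x, w, hx, hw, hc, hr⟩ := ih
      have hx0 : (x 0 : F) ≠ 0 := fun h => hacc ⟨x, hx, by exact_mod_cast h⟩
      have hhw : ρ (aux 2) w = 0 := by
        have := LinearMap.congr_fun hh w
        rw [Module.End.mul_apply, hr, map_smul, LinearMap.zero_apply] at this
        exact (smul_eq_zero.1 this).resolve_left hx0
      obtain ⟨i, hi⟩ : ∃ i, ρ (fwd i) w ≠ 0 := by
        by_contra! h
        have := LinearMap.congr_fun hT w
        simp [hhw, LinearMap.sum_apply, h] at this
        exact hw this.symm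
      refine ⟨fun j => ((P i).upd j).eval x, ρ (fwd i) w, hx.tail ⟨i, ?_, rfl⟩, hi, ?_, fun j => ?_⟩
      · have := LinearMap.congr_fun (hguard i) w
        rw [Module.End.mul_apply, Module.End.mul_apply, eval_apply_eigenvector hr,
          eval_apply_eigenvector hr, map_smul, map_smul] at this
        exact_mod_cast smul_left_injective F hi this
      · have := LinearMap.congr_fun (hcS i) w
        rw [Module.End.mul_apply, LinearMap.add_apply, Module.End.mul_apply, hc, map_smul] at this
        rw [this, Nat.cast_succ, add_smul, one_smul]
      · have := LinearMap.congr_fun (hupd i j) w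
        rwa [Module.End.mul_apply, Module.End.mul_apply, eval_apply_eigenvector hr,
          map_smul] at this
  have hfin := Module.End.finite_hasEigenvalue (ρ (aux 0))
  refine Set.infinite_range_of_injective (Nat.cast_injective (R := F)) (hfin.subset ?_)
  rintro _ ⟨t, rfl⟩
  obtain ⟨x, w, -, hw, hc, -⟩ := key t
  exact Module.End.hasEigenvalue_of_hasEigenvector ⟨Module.End.mem_eigenspace_iff.2 hc, hw⟩

end Soundness

section Completeness

theorem _root_.RingTerm.map_eval {σ : Type} {R S : Type*} [Semiring R] [Semiring S] (φ : R →+* S)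
    (ρ : σ → R) (t : RingTerm σ) : φ (t.eval ρ) = t.eval fun i => φ (ρ i) := by
  induction t <;> simp_all [eval]

theorem exists_run {x y : Fin (M + 1) → ℕ} (h : Relation.ReflTransGen (Step P) x y) :
    ∃ (T : ℕ) (z : Fin (T + 1) → Fin (M + 1) → ℕ) (r : Fin T → Fin k), z 0 = x ∧
      z (Fin.last T) = y ∧ ∀ t, (P (r t)).Step (z t.castSucc) (z t.succ) := by
  induction h using Relation.ReflTransGen.head_induction_on with
  | refl => exact ⟨0, fun _ => y, Fin.elim0, rfl, rfl, fun t => t.elim0⟩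
  | head hac _ ih =>
    obtain ⟨T, z, r, hz, hy, hr⟩ := ih
    obtain ⟨i, hi⟩ := hac
    refine ⟨T + 1, Fin.cons _ z, Fin.cons i r, rfl, by rw [← Fin.succ_last, Fin.cons_succ, hy],
      Fin.cases ?_ fun t => ?_⟩
    · simpa [hz] using hi
    · simpa [Fin.castSucc_succ] using hr t

variable (F : Type*) [Field F] {T : ℕ}

/-- The shift to the next index, restricted to the transitions in `p`. -/
def shiftUp (p : Fin T → Prop) [DecidablePred p] : Module.End F (Fin (T + 1) → F) where
  toFun w := Fin.cons 0 fun t => if p t then w t.castSucc else 0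
  map_add' w w' := by
    ext j
    refine Fin.cases ?_ (fun t => ?_) j
    · simp
    · by_cases h : p t <;> simp [h]
  map_smul' a w := by
    ext j
    refine Fin.cases ?_ (fun t => ?_) j
    · simp
    · by_cases h : p t <;> simp [h]

/-- The shift to the previous index, restricted to the transitions in `p`. -/
def shiftDown (p : Fin T → Prop) [DecidablePred p] : Module.End F (Fin (T + 1) → F) where
  toFun w := Fin.snoc (α := fun _ => F) (fun t => if p t then w t.succ else 0) 0
  map_add' w w' := by
    ext j
    refine Fin.lastCases ?_ (fun t => ?_) j
    · simp
    · by_cases h : p t <;> simp [h]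
  map_smul' a w := by
    ext j
    refine Fin.lastCases ?_ (fun t => ?_) j
    · simp
    · by_cases h : p t <;> simp [h]

variable (p : Fin T → Prop) [DecidablePred p] (w : Fin (T + 1) → F) (t : Fin T)

@[simp] theorem shiftUp_zero : shiftUp F p w 0 = 0 := rfl

@[simp] theorem shiftUp_succ : shiftUp F p w t.succ = if p t then w t.castSucc else 0 := rfl

@[simp] theorem shiftDown_last : shiftDown F p w (Fin.last T) = 0 := by
  simp [shiftDown]

@[simp] theorem shiftDown_castSucc :
    shiftDown F p w t.castSucc = if p t then w t.succ else 0 := by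
  simp [shiftDown]

variable {P init} in
/-- An accepting run yields a finite-dimensional solution of the equations. -/
theorem exists_model_of_accepts {n : ℕ} (h : Accepts P fun j => (init j).eval fun _ => n) :
    ∃ (T : ℕ) (ρ : Op M k → Module.End F (Fin (T + 1) → F)),
      ∀ p ∈ eqs P init n, p.1.eval ρ = p.2.eval ρ := by
  obtain ⟨y, hy, hy0⟩ := h
  obtain ⟨T, z, r, hz, rfl, hr⟩ := exists_run P hy
  let D : (Fin (T + 1) → F) →ₐ[F] Module.End F (Fin (T + 1) → F) := Algebra.lmul F _
  have hD : ∀ d w j, D d w j = d j * w j := fun _ _ _ => rfl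
  let d : Fin (M + 1) → Fin (T + 1) → F := fun j t => z t j
  have heval : ∀ (s : RingTerm (Fin (M + 1))) w t,
      s.eval (fun j => D (d j)) w t = (s.eval (z t) : ℕ) * w t := by
    intro s w t
    have h1 := RingTerm.map_eval (D : _ →+* Module.End F (Fin (T + 1) → F)) d s
    have h2 := RingTerm.map_eval (Pi.evalRingHom (fun _ : Fin (T + 1) => F) t) d s
    have h3 := RingTerm.map_eval (Nat.castRingHom F) (z t) s
    change D (s.eval d) = s.eval (fun j => D (d j)) at h1
    rw [← h1, hD]
    exact congrArg (· * w t) (h2.trans h3.symm)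
  have hcast : ∀ (a : ℕ) (w : Fin (T + 1) → F) t, ((a : Module.End F (Fin (T + 1) → F)) w) t =
      a * w t := fun a w t => by simp [Module.End.natCast_apply]
  refine ⟨T, Sum.elim ![D fun t => (t : ℕ), D (Pi.single 0 1), D (Pi.single (Fin.last T) 1),
    shiftDown F fun _ => True, shiftUp F fun _ => True, (n : Module.End F _)]
    (Sum.elim (fun j => D (d j)) (Sum.elim (fun i => shiftUp F fun t => r t = i)
      fun i => shiftDown F fun t => r t = i)), ?_⟩
  rw [forall_mem_eqs_iff]
  refine ⟨rfl, ?_, ?_, ?_, ?_, ?_, fun j => ?_, fun i => ?_, fun i => ?_, fun i j => ?_⟩ <;>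
    refine LinearMap.ext fun w => funext fun t => ?_
  · refine Fin.cases ?_ (fun t => ?_) t <;> simp [hD]
  · refine Fin.lastCases ?_ (fun t => ?_) t <;> simp [hD, add_mul]
  · refine Fin.cases ?_ (fun t => ?_) t <;> simp [hD]
  · refine Fin.lastCases ?_ (fun t => ?_) t <;> simp [hD, LinearMap.sum_apply]
  · refine Fin.lastCases ?_ (fun t => ?_) t <;> simp [hD, d, hy0]
  · have h1 : (init j).eval (fun _ => (n : Module.End F (Fin (T + 1) → F))) =
        ((init j).eval fun _ => n : ℕ) :=
      (RingTerm.map_eval (Nat.castRingHom (Module.End F (Fin (T + 1) → F))) (fun _ => n)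
        (init j)).symm
    refine Fin.cases ?_ (fun t => ?_) t <;> simp [hD, d, h1, hcast, hz]
  · refine Fin.cases ?_ (fun t => ?_) t
    · simp
    · by_cases h : r t = i
      · have := (hr t).1
        rw [h] at this
        simp [heval, h, this]
      · simp [h]
  · refine Fin.cases ?_ (fun t => ?_) t
    · simp [hD]
    · by_cases h : r t = i <;> simp [hD, h, add_mul]
  · refine Fin.cases ?_ (fun t => ?_) t
    · simp [hD]
    · by_cases h : r t = i
      · have := congrFun (hr t).2 j
        rw [h] at this
        simp [hD, d, heval, h, this]
      · simp [hD, h]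

end Completeness

end Machine

/-! ### Derivations in Horn theories by register machines -/

/-- A Horn clause; facts are natural numbers, given by polynomials in `V` variables. -/
structure HornClause (V : ℕ) where
  /-- The conclusion. -/
  head : RingTerm (Fin V)
  /-- The premises. -/
  body : List (RingTerm (Fin V))

namespace HornClause

variable {V : ℕ}

/-- The facts derivable from a set of Horn clauses. -/
inductive Derives (C : List (HornClause V)) : ℕ → Prop
  | intro (h : HornClause V) (hC : h ∈ C) (v : Fin V → ℕ)
      (hb : ∀ b ∈ h.body, Derives C (b.eval v)) : Derives C (h.head.eval v)

/-- A polynomial pairing function. -/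
def join (a b : ℕ) : ℕ := (a + b) * (a + b) + a

theorem join_inj {a b a' b' : ℕ} : join a b = join a' b' ↔ a = a' ∧ b = b' := by
  refine ⟨fun h => ?_, by rintro ⟨rfl, rfl⟩; rfl⟩
  unfold join at h
  have hs : a + b = a' + b' := by
    rcases lt_trichotomy (a + b) (a' + b') with hlt | heq | hlt
    · nlinarith
    · exact heq
    · nlinarith
  rw [hs] at h
  omega

/-- The code of a non-empty stack. -/
def push (a s : ℕ) : ℕ := join a s + 1

theorem push_inj {a b a' b' : ℕ} : push a b = push a' b' ↔ a = a' ∧ b = b' := by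
  simp [push, join_inj]

/-- The term version of `join`. -/
def joinTerm {σ : Type} (a b : RingTerm σ) : RingTerm σ := .add (.mul (.add a b) (.add a b)) a

/-- The term version of `push`. -/
def pushTerm {σ : Type} (a b : RingTerm σ) : RingTerm σ := .add (joinTerm a b) .one

@[simp] theorem eval_joinTerm {σ : Type} (v : σ → ℕ) (a b : RingTerm σ) :
    (joinTerm a b).eval v = join (a.eval v) (b.eval v) := rfl

@[simp] theorem eval_pushTerm {σ : Type} (v : σ → ℕ) (a b : RingTerm σ) :
    (pushTerm a b).eval v = push (a.eval v) (b.eval v) := rfl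

theorem eval_foldr_pushTerm {σ : Type} (v : σ → ℕ) (l : List (RingTerm σ)) (s : RingTerm σ) :
    (l.foldr pushTerm s).eval v = (l.map fun b => b.eval v).foldr push (s.eval v) := by
  induction l <;> simp_all

/-- The rule replacing the conclusion of a clause at the top of the stack in register `0` by its
premises; register `1` has to hold the rest of the stack and the others the variables. -/
def rule (h : HornClause V) : MachineRule (V + 1) where
  guard := (.var 0, pushTerm (h.head.rename fun j => j.succ.succ) (.var 1))
  upd := Fin.cons ((h.body.map fun b => b.rename fun j => j.succ.succ).foldr pushTerm (.var 1))
    fun _ => .zero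

/-- The rule incrementing register `j + 1`. -/
def incRule (j : Fin (V + 1)) : MachineRule (V + 1) where
  guard := (.zero, .zero)
  upd i := if i = j.succ then .add (.var i) .one else .var i

/-- The rules of the machine searching for derivations. -/
def rules (C : List (HornClause V)) : List (MachineRule (V + 1)) :=
  (List.finRange (V + 1)).map incRule ++ C.map rule

/-- The machine searching for derivations. -/
def machine (C : List (HornClause V)) : Fin (rules C).length → MachineRule (V + 1) := (rules C).get

theorem step_machine_iff {C : List (HornClause V)} {x y : Fin (V + 2) → ℕ} :
    Machine.Step (machine C) x y ↔
      (∃ j, (incRule j).Step x y) ∨ ∃ h ∈ C, (rule h).Step x y := by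
  have : Machine.Step (machine C) x y ↔ ∃ r ∈ rules C, r.Step x y := by
    simp [Machine.Step, machine, List.mem_iff_get]
  rw [this]
  simp [rules, or_and_right, exists_or]

theorem step_incRule_iff {j : Fin (V + 1)} {x y : Fin (V + 2) → ℕ} :
    (incRule j).Step x y ↔ y = Function.update x j.succ (x j.succ + 1) := by
  simp only [MachineRule.Step, incRule, true_and]
  refine Eq.congr_right (funext fun i => ?_)
  by_cases h : i = j.succ
  · subst h; simp [RingTerm.eval]
  · simp [RingTerm.eval, h]

theorem step_rule_iff {h : HornClause V} {x y : Fin (V + 2) → ℕ} :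
    (rule h).Step x y ↔ x 0 = push (h.head.eval fun j => x j.succ.succ) (x 1) ∧
      y = Fin.cons ((h.body.map fun b => b.eval fun j => x j.succ.succ).foldr push (x 1))
        fun _ => 0 := by
  simp only [MachineRule.Step, rule]
  refine and_congr ?_ (Eq.congr_right (funext fun i => ?_))
  · simp [RingTerm.eval, RingTerm.eval_rename]
  · refine Fin.cases ?_ (fun i => ?_) i
    · simp [eval_foldr_pushTerm, RingTerm.eval_rename, RingTerm.eval, Function.comp_def]
    · simp [RingTerm.eval]

theorem exists_eq_append_of_foldr_push {l m : List ℕ} {s : ℕ}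
    (h : l.foldr push 0 = m.foldr push s) : ∃ l', l = m ++ l' ∧ s = l'.foldr push 0 := by
  induction m generalizing l with
  | nil => exact ⟨l, rfl, h.symm⟩
  | cons a m ih =>
    cases l with
    | nil => simp [push] at h
    | cons b l =>
      obtain ⟨rfl, h'⟩ := push_inj.1 h
      obtain ⟨l', rfl, hs⟩ := ih h'
      exact ⟨l', rfl, hs⟩

theorem exists_stack_of_accepts {C : List (HornClause V)} {x : Fin (V + 2) → ℕ}
    (h : Machine.Accepts (machine C) x) :
    ∃ l : List ℕ, x 0 = l.foldr push 0 ∧ ∀ c ∈ l, Derives C c := by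
  obtain ⟨y, hxy, hy⟩ := h
  induction hxy using Relation.ReflTransGen.head_induction_on with
  | refl => exact ⟨[], hy, by simp⟩
  | head hac _ ih =>
    obtain ⟨l, hl, hd⟩ := ih
    rcases step_machine_iff.1 hac with ⟨j, hj⟩ | ⟨h, hC, hs⟩
    · rw [step_incRule_iff] at hj
      refine ⟨l, ?_, hd⟩
      rw [← hl, hj, Function.update_of_ne (Fin.succ_ne_zero j).symm]
    · obtain ⟨h1, rfl⟩ := step_rule_iff.1 hs
      obtain ⟨l', rfl, hs'⟩ := exists_eq_append_of_foldr_push hl.symm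
      refine ⟨_ :: l', by rw [h1, hs']; rfl, ?_⟩
      simp only [List.mem_append, List.mem_map] at hd
      simp only [List.mem_cons, forall_eq_or_imp]
      exact ⟨.intro h hC _ fun b hb => hd _ (Or.inl ⟨b, hb, rfl⟩), fun c hc => hd c (Or.inr hc)⟩

theorem reach_add {C : List (HornClause V)} (z x : Fin (V + 2) → ℕ) (hz : z 0 = 0) :
    Relation.ReflTransGen (Machine.Step (machine C)) x (x + z) := by
  induction hn : ∑ j, z j generalizing z with
  | zero =>
    have : z = 0 := funext fun j => by
      simpa using (Finset.sum_eq_zero_iff.1 hn) j (Finset.mem_univ j)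
    rw [this, add_zero]
  | succ n ih =>
    obtain ⟨j, hj⟩ : ∃ j, z j ≠ 0 := by
      by_contra! h
      simp [h] at hn
    obtain ⟨i, rfl⟩ : ∃ i : Fin (V + 1), j = i.succ :=
      ⟨_, (Fin.succ_pred j (by rintro rfl; exact hj hz)).symm⟩
    have hz' : z = Function.update z i.succ (z i.succ - 1) + Pi.single i.succ 1 := by
      funext m
      by_cases hm : m = i.succ
      · subst hm; simp; omega
      · simp [hm]
    refine (ih (Function.update z i.succ (z i.succ - 1)) ?_ ?_).tail
      (step_machine_iff.2 (Or.inl ⟨i, step_incRule_iff.2 ?_⟩))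
    · rw [Function.update_of_ne (Fin.succ_ne_zero i).symm, hz]
    · have := congrArg (fun f : Fin (V + 2) → ℕ => ∑ j, f j) hz'
      simp only [Pi.add_apply, Finset.sum_add_distrib, Finset.sum_pi_single', Finset.mem_univ,
        if_true] at this
      omega
    · funext m
      by_cases hm : m = i.succ
      · subst hm; simp; omega
      · simp [hm]

theorem reach_of_derives {C : List (HornClause V)} {c : ℕ} (h : Derives C c) (s : ℕ) :
    Relation.ReflTransGen (Machine.Step (machine C)) (Fin.cons (push c s) fun _ => 0)
      (Fin.cons s fun _ => 0) := by
  induction h generalizing s with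
  | intro h hC v _ ih =>
    have hpop : ∀ l : List (RingTerm (Fin V)), (∀ b ∈ l, b ∈ h.body) →
        Relation.ReflTransGen (Machine.Step (machine C))
          (Fin.cons ((l.map fun b => b.eval v).foldr push s) fun _ => 0)
          (Fin.cons s fun _ => 0) := by
      intro l hl
      induction l with
      | nil => exact .refl
      | cons b l ihl =>
        exact (ih b (hl b (by simp)) _).trans (ihl fun b hb => hl b (by simp [hb]))
    have h1 : (Fin.cons 0 (Fin.cons s v : Fin (V + 1) → ℕ) : Fin (V + 2) → ℕ) 1 = s := rfl
    refine (reach_add (Fin.cons 0 (Fin.cons s v)) _ rfl).trans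
      (.head (step_machine_iff.2 (Or.inr ⟨h, hC, step_rule_iff.2 ⟨?_, rfl⟩⟩)) ?_)
    · simp [h1]
    · simpa [h1] using hpop h.body fun _ hb => hb

theorem accepts_iff_derives {C : List (HornClause V)} {c : ℕ} :
    Machine.Accepts (machine C) (Fin.cons (push c 0) fun _ => 0) ↔ Derives C c := by
  refine ⟨fun h => ?_, fun h => ⟨_, reach_of_derives h 0, rfl⟩⟩
  obtain ⟨l, hl, hd⟩ := exists_stack_of_accepts h
  obtain ⟨l', rfl, -⟩ := exists_eq_append_of_foldr_push (m := [c]) (s := 0) hl.symm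
  exact hd c (by simp)

end HornClause

/-! ### A Horn theory of halting computations -/

namespace CodeHorn

open HornClause
open Nat.Partrec (Code)

/-- A fact about `a`, `b`, `x` of kind `k`: kind `0` is `Nat.pair a b = x`, kind `1` says that a
fixed code halts on `a`, and kind `encode c + 2` says that the code `c` maps `a` to `x`. -/
def atom (k a b x : ℕ) : ℕ := join k (join a (join b x))

/-- The truth of a fact. -/
def Holds (c₀ : Code) : ℕ → ℕ → ℕ → ℕ → Prop
  | 0, a, b, x => Nat.pair a b = x
  | 1, a, _, _ => (c₀.eval a).Dom
  | k + 2, a, _, x => x ∈ (Denumerable.ofNat Code k).eval a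

/-- The truth of an encoded fact. -/
def HoldsAtom (c₀ : Code) (n : ℕ) : Prop := ∃ k a b x, n = atom k a b x ∧ Holds c₀ k a b x

theorem holdsAtom_atom {c₀ : Code} {k a b x : ℕ} :
    HoldsAtom c₀ (atom k a b x) ↔ Holds c₀ k a b x := by
  refine ⟨?_, fun h => ⟨k, a, b, x, rfl, h⟩⟩
  rintro ⟨k', a', b', x', h, h'⟩
  simp only [atom, join_inj] at h
  obtain ⟨rfl, rfl, rfl, rfl⟩ := h
  exact h'

theorem holds_code {c₀ c : Code} {a b x : ℕ} :
    Holds c₀ (Encodable.encode c + 2) a b x ↔ x ∈ c.eval a := by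
  simp [Holds]

/-- The term version of `atom`. -/
def atomTerm {σ : Type} (k : ℕ) (a b x : RingTerm σ) : RingTerm σ :=
  joinTerm (.num k) (joinTerm a (joinTerm b x))

theorem eval_atomTerm {σ : Type} (v : σ → ℕ) (k : ℕ) (a b x : RingTerm σ) :
    (atomTerm k a b x).eval v = atom k (a.eval v) (b.eval v) (x.eval v) := by
  simp [atomTerm, atom, RingTerm.eval_num]

/-- The term of the fact `Nat.pair a b = x`. -/
def pairs (a b x : RingTerm (Fin 8)) : RingTerm (Fin 8) := atomTerm 0 a b x

/-- The term of the fact that `c` maps `a` to `x`. -/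
def maps (c : Code) (a x : RingTerm (Fin 8)) : RingTerm (Fin 8) :=
  atomTerm (Encodable.encode c + 2) a .zero x

open RingTerm in
/-- The clauses describing `Nat.pair`. -/
def pairClauses : List (HornClause 8) :=
  [⟨pairs (var 0) (add (add (var 0) one) (var 1))
      (add (mul (add (add (var 0) one) (var 1)) (add (add (var 0) one) (var 1))) (var 0)), []⟩,
   ⟨pairs (add (var 0) (var 1)) (var 0)
      (add (add (mul (add (var 0) (var 1)) (add (var 0) (var 1))) (add (var 0) (var 1))) (var 0)),
      []⟩]

open RingTerm in
/-- The clauses describing a code and its subcodes. -/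
def codeClauses : Code → List (HornClause 8)
  | .zero => [⟨maps .zero (var 0) zero, []⟩]
  | .succ => [⟨maps .succ (var 0) (add (var 0) one), []⟩]
  | .left => [⟨maps .left (var 0) (var 1), [pairs (var 1) (var 2) (var 0)]⟩]
  | .right => [⟨maps .right (var 0) (var 1), [pairs (var 2) (var 1) (var 0)]⟩]
  | .pair f g => ⟨maps (.pair f g) (var 0) (var 1),
      [maps f (var 0) (var 2), maps g (var 0) (var 3), pairs (var 2) (var 3) (var 1)]⟩ ::
      (codeClauses f ++ codeClauses g)
  | .comp f g => ⟨maps (.comp f g) (var 0) (var 1),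
      [maps g (var 0) (var 2), maps f (var 2) (var 1)]⟩ :: (codeClauses f ++ codeClauses g)
  | .prec f g =>
      ⟨maps (.prec f g) (var 0) (var 1), [pairs (var 2) zero (var 0), maps f (var 2) (var 1)]⟩ ::
      ⟨maps (.prec f g) (var 0) (var 1),
        [pairs (var 2) (add (var 3) one) (var 0), pairs (var 2) (var 3) (var 4),
          maps (.prec f g) (var 4) (var 5), pairs (var 3) (var 5) (var 6),
          pairs (var 2) (var 6) (var 7), maps g (var 7) (var 1)]⟩ ::
      (codeClauses f ++ codeClauses g)
  | .rfind' f =>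
      ⟨maps (.rfind' f) (var 0) (var 1), [maps f (var 0) zero, pairs (var 2) (var 1) (var 0)]⟩ ::
      ⟨maps (.rfind' f) (var 0) (var 1),
        [maps f (var 0) (add (var 2) one), pairs (var 3) (var 4) (var 0),
          pairs (var 3) (add (var 4) one) (var 5), maps (.rfind' f) (var 5) (var 1)]⟩ ::
      codeClauses f

/-- The clauses describing the halting of a code. -/
def haltClauses (c₀ : Code) : List (HornClause 8) :=
  ⟨atomTerm 1 (.var 0) .zero .zero, [maps c₀ (.var 0) (.var 1)]⟩ ::
    (pairClauses ++ codeClauses c₀)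

theorem holdsAtom_pairs {c₀ : Code} {a b x : RingTerm (Fin 8)} {v : Fin 8 → ℕ} :
    HoldsAtom c₀ ((pairs a b x).eval v) ↔ Nat.pair (a.eval v) (b.eval v) = x.eval v := by
  rw [pairs, eval_atomTerm, holdsAtom_atom, Holds]

theorem holdsAtom_maps {c₀ c : Code} {a x : RingTerm (Fin 8)} {v : Fin 8 → ℕ} :
    HoldsAtom c₀ ((maps c a x).eval v) ↔ x.eval v ∈ c.eval (a.eval v) := by
  rw [maps, eval_atomTerm, holdsAtom_atom, holds_code]

theorem mem_eval_zero {n m : ℕ} : m ∈ Code.zero.eval n ↔ m = 0 := Part.mem_some_iff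

theorem mem_eval_succ {n m : ℕ} : m ∈ Code.succ.eval n ↔ m = n + 1 := Part.mem_some_iff

theorem mem_eval_left {n m : ℕ} : m ∈ Code.left.eval n ↔ m = n.unpair.1 := Part.mem_some_iff

theorem mem_eval_right {n m : ℕ} : m ∈ Code.right.eval n ↔ m = n.unpair.2 := Part.mem_some_iff

theorem mem_eval_pair {f g : Code} {n m : ℕ} : m ∈ (Code.pair f g).eval n ↔
    ∃ a ∈ f.eval n, ∃ b ∈ g.eval n, Nat.pair a b = m := by
  change m ∈ (Part.map Nat.pair (f.eval n)).bind (fun h => (g.eval n).map h) ↔ _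
  simp only [Part.mem_bind_iff, Part.mem_map_iff]
  constructor
  · rintro ⟨_, ⟨a, ha, rfl⟩, b, hb, h⟩
    exact ⟨a, ha, b, hb, h⟩
  · rintro ⟨a, ha, b, hb, h⟩
    exact ⟨_, ⟨a, ha, rfl⟩, b, hb, h⟩

theorem mem_eval_comp {f g : Code} {n m : ℕ} : m ∈ (Code.comp f g).eval n ↔
    ∃ a ∈ g.eval n, m ∈ f.eval a := Part.mem_bind_iff

theorem mem_eval_prec_zero {f g : Code} {a m : ℕ} :
    m ∈ (Code.prec f g).eval (Nat.pair a 0) ↔ m ∈ f.eval a := by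
  rw [Code.eval_prec_zero]

theorem mem_eval_prec_succ {f g : Code} {a y m : ℕ} :
    m ∈ (Code.prec f g).eval (Nat.pair a (y + 1)) ↔
      ∃ l ∈ (Code.prec f g).eval (Nat.pair a y), m ∈ g.eval (Nat.pair a (Nat.pair y l)) := by
  rw [← Nat.succ_eq_add_one, Code.eval_prec_succ]
  exact Part.mem_bind_iff

theorem mem_eval_rfind' {f : Code} {a m r : ℕ} : r ∈ (Code.rfind' f).eval (Nat.pair a m) ↔
    m ≤ r ∧ 0 ∈ f.eval (Nat.pair a r) ∧
      ∀ j, m ≤ j → j < r → ∃ l, l + 1 ∈ f.eval (Nat.pair a j) := by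
  have key : r ∈ (Code.rfind' f).eval (Nat.pair a m) ↔ ∃ n,
      ((∃ l ∈ f.eval (Nat.pair a (n + m)), decide (l = 0) = true) ∧ ∀ {j}, j < n →
        ∃ l ∈ f.eval (Nat.pair a (j + m)), decide (l = 0) = false) ∧ n + m = r := by
    simp only [Code.eval, Nat.unpaired, Nat.unpair_pair, Part.mem_map_iff]
    refine exists_congr fun n => and_congr_left fun _ => ?_
    refine Nat.mem_rfind.trans (and_congr ?_ (forall_congr' fun j => imp_congr_right fun _ => ?_))
    · exact Part.mem_map_iff _
    · exact Part.mem_map_iff _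
  rw [key]
  constructor
  · rintro ⟨n, ⟨⟨x, hx, hx0⟩, hn⟩, rfl⟩
    refine ⟨by omega, by simpa [of_decide_eq_true hx0] using hx, fun j hj hjr => ?_⟩
    obtain ⟨l, hl, hl0⟩ := hn (j := j - m) (by omega)
    rw [Nat.sub_add_cancel hj] at hl
    obtain ⟨l, rfl⟩ := Nat.exists_eq_succ_of_ne_zero (of_decide_eq_false hl0)
    exact ⟨l, hl⟩
  · rintro ⟨hmr, h0, hj⟩
    refine ⟨r - m, ⟨⟨0, by rwa [Nat.sub_add_cancel hmr], by simp⟩, fun {j} hjr => ?_⟩, by omega⟩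
    obtain ⟨l, hl⟩ := hj (j + m) (by omega) (by omega)
    exact ⟨l + 1, hl, by simp⟩

theorem holds_of_mem_codeClauses {c₀ : Code} (c : Code) : ∀ h ∈ codeClauses c, ∀ v : Fin 8 → ℕ,
    (∀ b ∈ h.body, HoldsAtom c₀ (b.eval v)) → HoldsAtom c₀ (h.head.eval v) := by
  induction c with
  | zero | succ =>
    simp only [codeClauses, List.forall_mem_singleton, holdsAtom_maps, RingTerm.eval,
      mem_eval_zero, mem_eval_succ]
    simp
  | left | right =>
    simp only [codeClauses, List.forall_mem_singleton, holdsAtom_maps, holdsAtom_pairs,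
      RingTerm.eval, mem_eval_left, mem_eval_right]
    intro v hb
    rw [← hb, Nat.unpair_pair]
  | pair f g hf hg =>
    simp only [codeClauses, List.forall_mem_cons, List.forall_mem_append, holdsAtom_maps,
      holdsAtom_pairs, RingTerm.eval, mem_eval_pair]
    exact ⟨fun v ⟨h1, h2, h3, _⟩ => ⟨_, h1, _, h2, h3⟩, hf, hg⟩
  | comp f g hf hg =>
    simp only [codeClauses, List.forall_mem_cons, List.forall_mem_append, holdsAtom_maps,
      RingTerm.eval, mem_eval_comp]
    exact ⟨fun v ⟨h1, h2, _⟩ => ⟨_, h1, h2⟩, hf, hg⟩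
  | prec f g hf hg =>
    simp only [codeClauses, List.forall_mem_cons, List.forall_mem_append, holdsAtom_maps,
      holdsAtom_pairs, RingTerm.eval]
    refine ⟨?_, ?_, hf, hg⟩
    · rintro v ⟨h1, h2, -⟩
      rwa [← h1, mem_eval_prec_zero]
    · rintro v ⟨h1, h2, h3, h4, h5, h6, -⟩
      rw [← h1, mem_eval_prec_succ]
      exact ⟨v 5, by rwa [h2], by rwa [h4, h5]⟩
  | rfind' f hf =>
    simp only [codeClauses, List.forall_mem_cons, holdsAtom_maps,
      holdsAtom_pairs, RingTerm.eval]
    refine ⟨?_, ?_, hf⟩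
    · rintro v ⟨h1, h2, -⟩
      rw [← h2] at h1 ⊢
      exact mem_eval_rfind'.2 ⟨le_rfl, h1, fun j hj hj' => absurd hj hj'.not_ge⟩
    · rintro v ⟨h1, h2, h3, h4, -⟩
      rw [← h3] at h4
      rw [← h2] at h1 ⊢
      obtain ⟨hle, h0, hj⟩ := mem_eval_rfind'.1 h4
      refine mem_eval_rfind'.2 ⟨by omega, h0, fun j hj1 hj2 => ?_⟩
      rcases hj1.eq_or_lt with rfl | hlt
      · exact ⟨_, h1⟩
      · exact hj j hlt hj2

theorem holds_of_derives {c₀ : Code} {n : ℕ} (h : Derives (haltClauses c₀) n) :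
    HoldsAtom c₀ n := by
  induction h with
  | intro h hC v _ ih =>
    simp only [haltClauses, pairClauses, List.mem_cons, List.mem_append, List.not_mem_nil,
      or_false] at hC
    rcases hC with rfl | (rfl | rfl) | hC
    · simp only [List.forall_mem_cons, holdsAtom_maps] at ih
      rw [eval_atomTerm, holdsAtom_atom]
      exact Part.dom_iff_mem.2 ⟨_, ih.1⟩
    · rw [holdsAtom_pairs]
      simp [RingTerm.eval, Nat.pair, show v 0 < v 0 + 1 + v 1 by omega]
    · rw [holdsAtom_pairs]
      simp [RingTerm.eval, Nat.pair]
    · exact holds_of_mem_codeClauses c₀ h hC v ih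

theorem derives_pairs {c₀ : Code} {a b x : RingTerm (Fin 8)} {v : Fin 8 → ℕ}
    (h : Nat.pair (a.eval v) (b.eval v) = x.eval v) :
    Derives (haltClauses c₀) ((pairs a b x).eval v) := by
  rw [pairs, eval_atomTerm, ← h]
  generalize a.eval v = a
  generalize b.eval v = b
  rcases lt_or_ge a b with h | h
  · obtain ⟨t, rfl⟩ := Nat.exists_eq_add_of_lt h
    have := Derives.intro (C := haltClauses c₀) pairClauses[0]
      (by simp [haltClauses, pairClauses]) ![a, t, 0, 0, 0, 0, 0, 0] (by simp [pairClauses])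
    convert this using 1
    simp [pairClauses, pairs, eval_atomTerm, RingTerm.eval, Nat.pair, h]
    ring_nf
  · obtain ⟨t, rfl⟩ := Nat.exists_eq_add_of_le h
    have := Derives.intro (C := haltClauses c₀) pairClauses[1]
      (by simp [haltClauses, pairClauses]) ![b, t, 0, 0, 0, 0, 0, 0] (by simp [pairClauses])
    convert this using 1
    simp [pairClauses, pairs, eval_atomTerm, RingTerm.eval, Nat.pair]

/-- The derivability of the fact that `c` maps `n` to `m`. -/
def DerivesMaps (c₀ c : Code) (n m : ℕ) : Prop :=
  Derives (haltClauses c₀) (atom (Encodable.encode c + 2) n 0 m)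

theorem derives_maps {c₀ c : Code} {a x : RingTerm (Fin 8)} {v : Fin 8 → ℕ} :
    Derives (haltClauses c₀) ((maps c a x).eval v) ↔
      DerivesMaps c₀ c (a.eval v) (x.eval v) := by
  rw [maps, eval_atomTerm]
  rfl

theorem derivesMaps_of_clause {c₀ c : Code} {a x : RingTerm (Fin 8)}
    {body : List (RingTerm (Fin 8))} (v : Fin 8 → ℕ)
    (hmem : (⟨maps c a x, body⟩ : HornClause 8) ∈ haltClauses c₀)
    (hb : ∀ b ∈ body, Derives (haltClauses c₀) (b.eval v)) :
    DerivesMaps c₀ c (a.eval v) (x.eval v) :=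
  derives_maps.1 (Derives.intro _ hmem v hb)

theorem derivesMaps_of_mem_eval {c₀ : Code} (c : Code) (hc : codeClauses c ⊆ haltClauses c₀) :
    ∀ ⦃n m⦄, m ∈ c.eval n → DerivesMaps c₀ c n m := by
  induction c with
  | zero =>
    intro n m h
    obtain rfl := mem_eval_zero.1 h
    exact derivesMaps_of_clause (a := .var 0) (x := .zero) ![n, 0, 0, 0, 0, 0, 0, 0]
      (hc List.mem_cons_self) (by simp)
  | succ =>
    intro n m h
    obtain rfl := mem_eval_succ.1 h
    exact derivesMaps_of_clause (a := .var 0) (x := .add (.var 0) .one) ![n, 0, 0, 0, 0, 0, 0, 0]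
      (hc List.mem_cons_self) (by simp)
  | left =>
    intro n m h
    obtain rfl := mem_eval_left.1 h
    exact derivesMaps_of_clause (a := .var 0) (x := .var 1) ![n, n.unpair.1, n.unpair.2, 0, 0, 0, 0, 0]
      (hc List.mem_cons_self) (by
        rw [List.forall_mem_singleton]
        exact derives_pairs (Nat.pair_unpair n))
  | right =>
    intro n m h
    obtain rfl := mem_eval_right.1 h
    exact derivesMaps_of_clause (a := .var 0) (x := .var 1) ![n, n.unpair.2, n.unpair.1, 0, 0, 0, 0, 0]
      (hc List.mem_cons_self) (by
        rw [List.forall_mem_singleton]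
        exact derives_pairs (Nat.pair_unpair n))
  | pair f g hf hg =>
    intro n m h
    have hcf := hf fun x hx => hc (by simp [codeClauses, hx])
    have hcg := hg fun x hx => hc (by simp [codeClauses, hx])
    obtain ⟨a, ha, b, hb, hab⟩ := mem_eval_pair.1 h
    refine derivesMaps_of_clause (a := .var 0) (x := .var 1) ![n, m, a, b, 0, 0, 0, 0] (hc List.mem_cons_self) ?_
    simp only [List.forall_mem_cons, derives_maps]
    exact ⟨hcf ha, hcg hb, derives_pairs hab, by simp⟩
  | comp f g hf hg =>
    intro n m h
    have hcf := hf fun x hx => hc (by simp [codeClauses, hx])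
    have hcg := hg fun x hx => hc (by simp [codeClauses, hx])
    obtain ⟨a, ha, hm⟩ := mem_eval_comp.1 h
    refine derivesMaps_of_clause (a := .var 0) (x := .var 1) ![n, m, a, 0, 0, 0, 0, 0] (hc List.mem_cons_self) ?_
    simp only [List.forall_mem_cons, derives_maps]
    exact ⟨hcg ha, hcf hm, by simp⟩
  | prec f g hf hg =>
    intro n m h
    have hcf := hf fun x hx => hc (by simp [codeClauses, hx])
    have hcg := hg fun x hx => hc (by simp [codeClauses, hx])
    rw [← Nat.pair_unpair n] at h ⊢
    generalize n.unpair.1 = a at h ⊢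
    generalize n.unpair.2 = y at h ⊢
    induction y generalizing m with
    | zero =>
      rw [mem_eval_prec_zero] at h
      refine derivesMaps_of_clause (a := .var 0) (x := .var 1) ![Nat.pair a 0, m, a, 0, 0, 0, 0, 0]
        (hc List.mem_cons_self) ?_
      simp only [List.forall_mem_cons, derives_maps]
      exact ⟨derives_pairs rfl, hcf h, by simp⟩
    | succ y ih =>
      obtain ⟨l, hl, hm⟩ := mem_eval_prec_succ.1 h
      refine derivesMaps_of_clause (a := .var 0) (x := .var 1) ![Nat.pair a (y + 1), m, a, y, Nat.pair a y, l, Nat.pair y l,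
        Nat.pair a (Nat.pair y l)] (hc (List.mem_cons_of_mem _ List.mem_cons_self)) ?_
      simp only [List.forall_mem_cons, derives_maps]
      exact ⟨derives_pairs rfl, derives_pairs rfl, ih hl, derives_pairs rfl, derives_pairs rfl,
        hcg hm, by simp⟩
  | rfind' f hf =>
    intro n m h
    have hcf := hf fun x hx => hc (by simp [codeClauses, hx])
    rw [← Nat.pair_unpair n] at h ⊢
    generalize n.unpair.1 = a at h ⊢
    generalize n.unpair.2 = y at h ⊢
    obtain ⟨hle, h0, hj⟩ := mem_eval_rfind'.1 h
    clear h
    induction hd : m - y generalizing y with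
    | zero =>
      obtain rfl : y = m := by omega
      refine derivesMaps_of_clause (a := .var 0) (x := .var 1) ![Nat.pair a y, y, a, 0, 0, 0, 0, 0]
        (hc List.mem_cons_self) ?_
      simp only [List.forall_mem_cons, derives_maps]
      exact ⟨hcf h0, derives_pairs rfl, by simp⟩
    | succ d ih =>
      obtain ⟨l, hl⟩ := hj y le_rfl (by omega)
      refine derivesMaps_of_clause (a := .var 0) (x := .var 1) ![Nat.pair a y, m, l, a, y, Nat.pair a (y + 1), 0, 0]
        (hc (List.mem_cons_of_mem _ List.mem_cons_self)) ?_
      simp only [List.forall_mem_cons, derives_maps]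
      exact ⟨hcf hl, derives_pairs rfl, derives_pairs rfl,
        ih (y + 1) (by omega) (fun j h1 h2 => hj j (by omega) h2) (by omega), by simp⟩

theorem derives_halt_iff {c₀ : Code} {n : ℕ} :
    Derives (haltClauses c₀) (atom 1 n 0 0) ↔ (c₀.eval n).Dom := by
  refine ⟨fun h => holdsAtom_atom.1 (holds_of_derives h), fun h => ?_⟩
  obtain ⟨m, hm⟩ := Part.dom_iff_mem.1 h
  have := Derives.intro (C := haltClauses c₀) _ List.mem_cons_self ![n, m, 0, 0, 0, 0, 0, 0] (by
    simp only [List.forall_mem_cons, derives_maps]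
    exact ⟨derivesMaps_of_mem_eval c₀ (fun x hx => by simp [haltClauses, hx]) hm, by simp⟩)
  rwa [eval_atomTerm] at this

end CodeHorn

/-! ### Undecidability -/

section Reduction

open Nat.Partrec (Code)
open Coord HornClause CodeHorn

/-- The initial state of the search for a proof that a fixed code halts on a given input. -/
def haltInit : Fin 10 → RingTerm Unit :=
  Fin.cons (pushTerm (atomTerm 1 (.var ()) .zero .zero) .zero) fun _ => .zero

/-- The ring equations saying that `c₀` halts on `n`. -/
def haltEqs (c₀ : Code) (n : ℕ) : List (RingTerm (Machine.Op 9 (rules (haltClauses c₀)).length) ×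
    RingTerm (Machine.Op 9 (rules (haltClauses c₀)).length)) :=
  Machine.eqs (machine (haltClauses c₀)) haltInit n

theorem accepts_haltInit_iff {c₀ : Code} {n : ℕ} :
    Machine.Accepts (machine (haltClauses c₀)) (fun j => (haltInit j).eval fun _ => n) ↔
      (c₀.eval n).Dom := by
  rw [← derives_halt_iff, ← accepts_iff_derives]
  refine iff_of_eq (congrArg _ (funext fun j => ?_))
  refine Fin.cases ?_ (fun j => ?_) j
  · simp [haltInit, eval_atomTerm, RingTerm.eval]
  · simp [haltInit, RingTerm.eval]

theorem exists_sat_haltEqs_iff (F : Type*) [Field F] [CharZero F] {c₀ : Code} {n : ℕ} :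
    (c₀.eval n).Dom ↔ ∃ d : ℕ, 1 ≤ d ∧ ∃ v : ℕ → Submodule F (Fin d → F),
      (latConj (haltEqs c₀ n)).Sat v ∧ (latConj (haltEqs c₀ n)).Nontriv v := by
  rw [← accepts_haltInit_iff]
  constructor
  · intro h
    obtain ⟨T, ρ, hρ⟩ := Machine.exists_model_of_accepts F h
    exact exists_sat_of_model ρ hρ
  · rintro ⟨d, -, v, hv, hn⟩
    obtain ⟨Z, W, _, ρ, hρ⟩ := exists_model_of_sat hv hn
    exact Machine.accepts_of_model hρ

theorem primrec₂_sup_code : Primrec₂ fun a b => 3 * Nat.pair a b + 1 :=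
  Primrec.nat_add.comp (Primrec.nat_mul.comp (Primrec.const 3) Primrec₂.natPair)
    (Primrec.const 1)

theorem primrec₂_inf_code : Primrec₂ fun a b => 3 * Nat.pair a b + 2 :=
  Primrec.nat_add.comp (Primrec.nat_mul.comp (Primrec.const 3) Primrec₂.natPair)
    (Primrec.const 2)

theorem primrec_code_latTerm_num {σ : Type} [Encodable σ] :
    Primrec fun n => (latTerm (RingTerm.num n : RingTerm σ)).code := by
  let inf (a b : ℕ) : ℕ := 3 * Nat.pair a b + 2
  let sup (a b : ℕ) : ℕ := 3 * Nat.pair a b + 1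
  let step (y : ℕ) : ℕ :=
    inf (sup (inf (sup 12 9) (sup (inf (sup y 15) (sup 3 9)) 6)) 15) (sup 3 6)
  have hstep : Primrec step := by
    have hs : ∀ {f : ℕ → ℕ} (b : ℕ), Primrec f → Primrec fun n => sup (f n) b :=
      fun b hf => primrec₂_sup_code.comp hf (Primrec.const b)
    have hi : ∀ {f : ℕ → ℕ} (b : ℕ), Primrec f → Primrec fun n => inf (f n) b :=
      fun b hf => primrec₂_inf_code.comp hf (Primrec.const b)
    exact hi _ (hs _ (primrec₂_inf_code.comp (Primrec.const _) (hs _ (hi _ (hs _ Primrec.id)))))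
  refine (Primrec.nat_rec₁ 3 (hstep.comp Primrec.snd).to₂).of_eq fun n => ?_
  induction n with
  | zero => rfl
  | succ n ih => exact congrArg step ih

theorem primrec_code_latConj_haltEqs (c₀ : Code) :
    Primrec fun n => (latConj (haltEqs c₀ n)).code :=
  Primrec.encode.comp (Primrec.list_cons.comp
    (Primrec₂.natPair.comp (Primrec.const _) primrec_code_latTerm_num) (Primrec.const _))

theorem exists_universal_code :
    ∃ c₀ : Code, ∀ n, (c₀.eval n).Dom ↔ ((Denumerable.ofNat Code n).eval 0).Dom := by
  have h : Partrec fun n : ℕ => (Denumerable.ofNat Code n).eval 0 :=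
    Code.eval_part.comp (Computable.ofNat Code) (Computable.const 0)
  obtain ⟨c, hc⟩ := Code.exists_code.1 (Partrec.nat_iff.1 h)
  exact ⟨c, fun n => by rw [hc]⟩

end Reduction

/-- For a field `F` of characteristic `0`, the set of
conjunctions of lattice equations admitting a non-trivial satisfying assignment
by subspaces of `F^d` for some finite `d ≥ 1` (with `⊓` interpreted as
intersection and `⊔` as sum of subspaces) is not decidable. -/
theorem subspace_lattice_consistency_undecidable
    (F : Type*) [Field F] [CharZero F] :
    ¬ ∃ f : ℕ → Bool, Computable f ∧
      ∀ Φ : LatConj, (f Φ.code = true ↔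
        ∃ d : ℕ, 1 ≤ d ∧ ∃ v : ℕ → Submodule F (Fin d → F),
          Φ.Sat v ∧ Φ.Nontriv v) := by
  rintro ⟨f, hf, hspec⟩
  obtain ⟨c₀, hc₀⟩ := exists_universal_code
  refine ComputablePred.halting_problem 0 (ComputablePred.computable_iff.2
    ⟨fun c => f (Coord.latConj (haltEqs c₀ (Encodable.encode c))).code,
      hf.comp ((primrec_code_latConj_haltEqs c₀).to_comp.comp Computable.encode), ?_⟩)
  funext c
  rw [eq_iff_iff, hspec, ← exists_sat_haltEqs_iff F, hc₀, Denumerable.ofNat_encode]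
end

section
/- The consistency problem for modular lattices remains unsolvable when restricted to conjunctions of lattice equations in at most five variables: the set of conjunctions of lattice equations in the variables x₁,…,x₅ that admit a non-trivial satisfying assignment in some modular lattice is not decidable. -/
/-! ### Finitely presented unary algebras

Functions `ℕ → ℕ` serve as unary operation symbols.  An equation `f ∘ g = h ∘ k` that is true of
the functions themselves may be imposed on an algebra interpreting these symbols. -/

/-- The true equations `f ∘ g = h ∘ k` between functions on the natural numbers. -/
abbrev TrueEq : Type :=
  {q : ((ℕ → ℕ) × (ℕ → ℕ)) × ((ℕ → ℕ) × (ℕ → ℕ)) // q.1.1 ∘ q.1.2 = q.2.1 ∘ q.2.2}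

/-- A pointed unary algebra satisfying the equations in `E`, in which `id` acts as the identity and
the constant function `0` fixes the base point. -/
structure UnaryModel (E : Finset TrueEq) (P : Type) where
  /-- the action of the operation symbols -/
  act : (ℕ → ℕ) → P → P
  /-- the base point -/
  base : P
  act_id : ∀ p, act id p = p
  act_zero_base : act (fun _ => 0) base = base
  act_eq : ∀ q ∈ E, ∀ p, act q.1.1.1 (act q.1.1.2 p) = act q.1.2.1 (act q.1.2.2 p)

/-- The point of a unary algebra that represents the number `n`. -/
def UnaryModel.pt {E : Finset TrueEq} {P : Type} (m : UnaryModel E P) (n : ℕ) : P :=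
  (m.act Nat.succ)^[n] m.base

theorem UnaryModel.act_succ_pt {E : Finset TrueEq} {P : Type} (m : UnaryModel E P) (n : ℕ) :
    m.act Nat.succ (m.pt n) = m.pt (n + 1) :=
  (Function.iterate_succ_apply' _ _ _).symm

/-- A function is *forced* if finitely many true equations determine its values on the points
representing numbers. -/
def Forced (f : ℕ → ℕ) : Prop :=
  ∀ᶠ E in (Filter.atTop : Filter (Finset TrueEq)),
    ∀ (P : Type) (m : UnaryModel E P) (n : ℕ), m.act f (m.pt n) = m.pt (f n)

theorem eventually_act_eq {f g h k : ℕ → ℕ} (hq : ∀ n, f (g n) = h (k n)) :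
    ∀ᶠ E in (Filter.atTop : Filter (Finset TrueEq)),
      ∀ (P : Type) (m : UnaryModel E P) (p : P), m.act f (m.act g p) = m.act h (m.act k p) := by
  filter_upwards [Filter.eventually_ge_atTop {(⟨((f, g), (h, k)), funext hq⟩ : TrueEq)}]
    with E hE P m p
  exact m.act_eq ⟨((f, g), (h, k)), funext hq⟩ (hE (Finset.mem_singleton_self _)) p

namespace Forced

theorem succ : Forced Nat.succ :=
  Filter.Eventually.of_forall fun _ _ m n => m.act_succ_pt n

theorem identity : Forced id :=
  Filter.Eventually.of_forall fun _ _ m _ => m.act_id _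

theorem comp {f g : ℕ → ℕ} (hf : Forced f) (hg : Forced g) : Forced (fun n => f (g n)) := by
  filter_upwards [hf, hg, eventually_act_eq (f := fun n => f (g n)) (g := id) (h := f) (k := g)
    fun _ => rfl] with E hf hg h P m n
  rw [← m.act_id (m.pt n), h, hg, hf]

theorem zero : Forced (fun _ => 0) := by
  filter_upwards [eventually_act_eq (f := fun _ => 0) (g := Nat.succ) (h := fun _ => 0) (k := id)
    fun _ => rfl] with E h P m n
  induction n with
  | zero => exact m.act_zero_base
  | succ n ih => rw [← m.act_succ_pt, h, m.act_id, ih]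

/-- Functions defined by pure iteration are forced. -/
theorem iterate {f w g : ℕ → ℕ} (hw : Forced w) (hg : Forced g) (h0 : f 0 = g 0)
    (hs : ∀ n, f (n + 1) = w (f n)) : Forced f := by
  filter_upwards [hw, hg, eventually_act_eq (f := f) (g := Nat.succ) (h := w) (k := f) hs,
    eventually_act_eq (f := f) (g := fun _ => 0) (h := g) (k := fun _ => 0) fun _ => h0]
    with E hw hg hs h0' P m n
  induction n with
  | zero =>
    have := h0' P m m.base
    rw [m.act_zero_base] at this
    rw [h0]
    exact this.trans (hg P m 0)
  | succ n ih => rw [← m.act_succ_pt, hs, ih, hw, ← ‹∀ n, f (n + 1) = w (f n)› n]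

theorem double : Forced (fun n => 2 * n) :=
  iterate (succ.comp succ) identity rfl fun _ => rfl

theorem double_add_one : Forced (fun n => 2 * n + 1) :=
  iterate (succ.comp succ) succ rfl fun _ => rfl

/-- Functions defined by recursion along trailing binary digits `1` are forced. -/
theorem binary {h u w : ℕ → ℕ} (hu : Forced u) (hw : Forced w) (h0 : ∀ a, h (2 * a) = u a)
    (h1 : ∀ n, h (2 * n + 1) = w (h n)) : Forced h := by
  filter_upwards [hu, hw, double, double_add_one,
    eventually_act_eq (f := h) (g := fun n => 2 * n) (h := u) (k := id) h0,
    eventually_act_eq (f := h) (g := fun n => 2 * n + 1) (h := w) (k := h) h1]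
    with E hu hw hd hd' e0 e1 P m n
  induction n using Nat.strong_induction_on with
  | _ n ih =>
    obtain ⟨a, rfl | rfl⟩ := Nat.even_or_odd' n
    · rw [← hd, e0, m.act_id, hu, h0]
    · rw [← hd', e1, ih a (by omega), hw, h1]

end Forced

/-- The function with `h (2 * a) = u a` and `h (2 * n + 1) = w (h n)`. -/
def oddRec (u w : ℕ → ℕ) (n : ℕ) : ℕ :=
  if h : n % 2 = 0 then u (n / 2) else w (oddRec u w (n / 2))
termination_by n
decreasing_by omega

theorem oddRec_double (u w : ℕ → ℕ) (a : ℕ) : oddRec u w (2 * a) = u a := by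
  rw [oddRec]; simp

theorem oddRec_double_add_one (u w : ℕ → ℕ) (n : ℕ) :
    oddRec u w (2 * n + 1) = w (oddRec u w n) := by
  rw [oddRec, dif_neg (by omega)]; congr 2; omega

theorem Forced.oddRec {u w : ℕ → ℕ} (hu : Forced u) (hw : Forced w) : Forced (oddRec u w) :=
  binary hu hw (oddRec_double u w) (oddRec_double_add_one u w)

/-- The pairing function `(a, b) ↦ 2 ^ b * (2 * a + 1) - 1`. -/
def pairOdd (a b : ℕ) : ℕ := (fun n => 2 * n + 1)^[b] (2 * a)

/-- The first projection for `pairOdd`. -/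
def fstOdd : ℕ → ℕ := oddRec id id

/-- The second projection for `pairOdd`. -/
def sndOdd : ℕ → ℕ := oddRec (fun _ => 0) Nat.succ

theorem pairOdd_zero (a : ℕ) : pairOdd a 0 = 2 * a := rfl

theorem pairOdd_succ (a b : ℕ) : pairOdd a (b + 1) = 2 * pairOdd a b + 1 :=
  Function.iterate_succ_apply' _ _ _

@[simp] theorem fstOdd_pairOdd (a b : ℕ) : fstOdd (pairOdd a b) = a := by
  induction b with
  | zero => exact oddRec_double _ _ _
  | succ b ih => rw [pairOdd_succ]; exact (oddRec_double_add_one _ _ _).trans ih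

@[simp] theorem sndOdd_pairOdd (a b : ℕ) : sndOdd (pairOdd a b) = b := by
  induction b with
  | zero => exact oddRec_double _ _ _
  | succ b ih =>
    rw [pairOdd_succ]; exact (oddRec_double_add_one _ _ _).trans (congrArg Nat.succ ih)

/-- A function of pairs given by iteration in the second component is forced. -/
theorem Forced.pairRec {h u w : ℕ → ℕ} (hu : Forced u) (hw : Forced w)
    (h0 : ∀ a, h (pairOdd a 0) = u a)
    (h1 : ∀ a b, h (pairOdd a (b + 1)) = w (h (pairOdd a b))) : Forced h := by
  refine binary hu hw h0 fun n => ?_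
  suffices ∃ a b, n = pairOdd a b by
    obtain ⟨a, b, rfl⟩ := this
    rw [← pairOdd_succ, h1]
  induction n using Nat.strong_induction_on with
  | _ n ih =>
    obtain ⟨a, rfl | rfl⟩ := Nat.even_or_odd' n
    · exact ⟨a, 0, rfl⟩
    · obtain ⟨a', b, hb⟩ := ih a (by omega)
      exact ⟨a', b + 1, by rw [pairOdd_succ, ← hb]⟩

namespace Forced

theorem fst : Forced fstOdd := identity.oddRec identity

theorem snd : Forced sndOdd := zero.oddRec succ

theorem map_fst {f : ℕ → ℕ} (hf : Forced f) :
    Forced (fun n => pairOdd (f (fstOdd n)) (sndOdd n)) :=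
  pairRec (double.comp hf) double_add_one (fun a => by rw [fstOdd_pairOdd, sndOdd_pairOdd]; rfl)
    fun a b => by simpa using pairOdd_succ (f a) b

theorem swap : Forced (fun n => pairOdd (sndOdd n) (fstOdd n)) := by
  have h0 : Forced (pairOdd 0) := iterate double_add_one identity rfl (pairOdd_succ 0)
  exact pairRec h0 (map_fst succ) (fun a => by simp) fun a b => by simp

theorem pair {f g : ℕ → ℕ} (hf : Forced f) (hg : Forced g) :
    Forced (fun n => pairOdd (f n) (g n)) := by
  have hd : Forced (fun n => pairOdd n n) :=
    iterate (double_add_one.comp (map_fst succ)) identity rfl fun n => by simp [pairOdd_succ]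
  simpa using (map_fst hf).comp (swap.comp ((map_fst hg).comp hd))

end Forced

/-- The vector of length `n` coded by a number via iterated pairing. -/
def vecOdd : (n : ℕ) → ℕ → List.Vector ℕ n
  | 0, _ => List.Vector.nil
  | n + 1, m => sndOdd m ::ᵥ vecOdd n (fstOdd m)

theorem forced_vecOdd_get : ∀ {n : ℕ} (i : Fin n), Forced (fun m => (vecOdd n m).get i)
  | n + 1, i => by
    refine Fin.cases ?_ (fun j => ?_) i
    · simpa [vecOdd] using Forced.snd
    · simpa [vecOdd] using (forced_vecOdd_get j).comp Forced.fst

theorem exists_forced_vecOdd_eq : ∀ {n : ℕ} (g : Fin n → ℕ → ℕ), (∀ i, Forced (g i)) →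
    ∃ e, Forced e ∧ ∀ m, vecOdd n (e m) = List.Vector.ofFn fun i => g i m
  | 0, _, _ => ⟨id, Forced.identity, fun _ => rfl⟩
  | n + 1, g, hg => by
    obtain ⟨e, he, h⟩ := exists_forced_vecOdd_eq (fun i => g i.succ) fun i => hg _
    exact ⟨_, he.pair (hg 0), fun m => by simp [vecOdd, h, List.Vector.ofFn]⟩

theorem forced_of_primrec {n : ℕ} {f : List.Vector ℕ n → ℕ} (hf : Nat.Primrec' f) :
    Forced (fun m => f (vecOdd n m)) := by
  induction hf with
  | zero => exact Forced.zero
  | succ => simpa [vecOdd] using Forced.succ.comp Forced.snd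
  | get i => exact forced_vecOdd_get i
  | comp g _ _ ihf ihg =>
    obtain ⟨e, he, h⟩ := exists_forced_vecOdd_eq _ ihg
    simpa [h] using ihf.comp he
  | @prec n f g _ _ ihf ihg =>
    have hw := ((Forced.fst.comp Forced.fst).pair
      (Forced.succ.comp (Forced.snd.comp Forced.fst))).pair
      (ihg.comp (((Forced.fst.comp Forced.fst).pair Forced.snd).pair
        (Forced.snd.comp Forced.fst)))
    let F (a b : ℕ) : ℕ := Nat.rec (f (vecOdd n a)) (fun y IH => g (y ::ᵥ IH ::ᵥ vecOdd n a)) b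
    have hst : Forced (fun m => pairOdd m (F (fstOdd m) (sndOdd m))) :=
      Forced.pairRec (Forced.double.pair ihf) hw
        (fun a => by rw [fstOdd_pairOdd, sndOdd_pairOdd]; rfl)
        fun a b => by simp [F, vecOdd]
    simpa [F, vecOdd] using Forced.snd.comp hst

/-- Finitely many true equations about functions on the natural numbers such that in every algebra
satisfying them a suitable operation takes the value `0` on the elements of `K`. -/
theorem exists_unary_presentation {K : ℕ → Prop} {g : ℕ → ℕ → ℕ}
    (hg : Nat.Primrec' (n := 2) fun v => g v.head v.tail.head)
    (hK : ∀ n, K n ↔ ∃ k, g k n = 0) :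
    ∃ (E : Finset TrueEq) (Q : ℕ → ℕ), (∀ n, ¬ K n → Q n = 1) ∧
      ∀ (P : Type) (m : UnaryModel E P) (n : ℕ), K n → m.act Q (m.pt n) = m.pt 0 := by
  classical
  let Q (n : ℕ) : ℕ := if K n then 0 else 1
  let T (m : ℕ) : ℕ := if sndOdd m = 0 then 0 else Q (fstOdd m)
  have hW : Forced fun m => pairOdd (fstOdd m) (g (sndOdd m) (fstOdd m)) := by
    have h1 : Forced fun m => g (sndOdd m) (fstOdd m) := by
      have h2 := (forced_of_primrec hg).comp
        (((Forced.zero.pair Forced.fst)).pair Forced.snd)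
      simpa [vecOdd] using h2
    exact Forced.fst.pair h1
  obtain ⟨E, hW, hT, hTW, hz, hd, hfst⟩ := (hW.and ((eventually_act_eq (f := T)
    (g := fun a => 2 * a) (h := fun _ => 0) (k := id) fun a => by simp [T, ← pairOdd_zero a]).and
    ((eventually_act_eq (f := T) (g := fun m => pairOdd (fstOdd m) (g (sndOdd m) (fstOdd m)))
      (h := Q) (k := fstOdd) fun m => by
        simp only [T, fstOdd_pairOdd, sndOdd_pairOdd]
        split_ifs with h
        · exact (if_pos ((hK _).2 ⟨_, h⟩)).symm
        · rfl).and
      (Forced.zero.and (Forced.double.and Forced.fst))))).exists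
  refine ⟨E, Q, fun n hn => if_neg hn, fun P m n hn => ?_⟩
  obtain ⟨k, hk⟩ := (hK n).1 hn
  have h1 := hTW P m (m.pt (pairOdd n k))
  rw [hW, hfst] at h1
  simp only [fstOdd_pairOdd, sndOdd_pairOdd, hk] at h1
  rw [← h1, pairOdd_zero, ← hd, hT, m.act_id, hz]

/-! ### Unary algebras inside modular lattices -/

/-- The ingredients of a unary algebra in a lattice: the elements `x` generating everything, a lower
bound `b`, a chain of independent elements `u`, axes of perspectivity `c` between neighbours in the
chain, a base point `z ≤ u 0`, an embedding `j` of `u 0` into a copy of `z`, and two copies `F f`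
and `G f` of the graph of each operation `f`. -/
structure Pattern (α : Type*) where
  /-- generators -/
  x : ℕ → α
  /-- lower bound -/
  b : α
  /-- chain of independent elements -/
  u : ℕ → α
  /-- axes of perspectivity between `u t` and `u (t + 1)` -/
  c : ℕ → α
  /-- base point -/
  z : α
  /-- graph of an embedding of `u 0` into the copy of `z` below `u 1` -/
  j : α
  /-- graphs of operations from `u 0` to `u 1` -/
  F : (ℕ → ℕ) → α
  /-- graphs of operations from `u 1` to `u 2` -/
  G : (ℕ → ℕ) → α

namespace Pattern

/-- Transport of a pattern along a map. -/
def map {α β : Type*} (φ : α → β) (y : Pattern α) : Pattern β where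
  x i := φ (y.x i)
  b := φ y.b
  u t := φ (y.u t)
  c t := φ (y.c t)
  z := φ y.z
  j := φ y.j
  F f := φ (y.F f)
  G f := φ (y.G f)

section Terms

variable {α : Type*} [Max α] [Min α] (y : Pattern α)

/-- The operation `f`, acting on elements below `u 0`. -/
def act (f : ℕ → ℕ) (p : α) : α := ((p ⊔ y.F f) ⊓ y.u 1 ⊔ y.c 0) ⊓ y.u 0

/-- The join of `u 0, …, u t`. -/
def joinU : ℕ → α
  | 0 => y.u 0
  | t + 1 => joinU t ⊔ y.u (t + 1)

/-- The graph of the composition of `f` and `g`, from `u 0` to `u 2`. -/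
def compGraph (f g : α) : α := (f ⊔ g) ⊓ (y.u 0 ⊔ y.u 2)

/-- The equation expressing `s ≤ t`. -/
def leEq (s t : α) : α × α := (s ⊓ t, s)

/-- The equations relating the generators to the chain `u 0, …, u M`. -/
def chainEqs (M : ℕ) : List (α × α) :=
  (List.range 5).map (fun i => leEq y.b (y.x i)) ++
  (List.range 5).map (fun i => leEq (y.x i) (y.joinU M)) ++
  (List.range M).map (fun t => leEq (y.u (t + 1)) (y.u t ⊔ y.c t)) ++
  (List.range M).map (fun t => (y.c t ⊓ y.u (t + 1), y.b))

/-- The equations for the first three elements of the chain, the base point and the embedding. -/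
def frameEqs : List (α × α) :=
  [leEq y.b (y.u 0), leEq y.b (y.u 1), ((y.u 0 ⊔ y.u 1) ⊓ (y.u 1 ⊔ y.u 2), y.u 1),
    (y.c 0 ⊓ y.u 0, y.b), leEq (y.u 0) (y.u 1 ⊔ y.c 0), leEq (y.c 0) (y.u 0 ⊔ y.u 1),
    (y.c 1 ⊓ y.u 1, y.b), leEq (y.u 1) (y.u 2 ⊔ y.c 1), leEq (y.c 1) (y.u 1 ⊔ y.u 2),
    (y.F id, y.c 0), leEq y.b y.z, leEq y.z (y.u 0), (y.act (fun _ => 0) y.z, y.z),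
    (y.z ⊓ y.act Nat.succ y.z, y.b), leEq (y.u 0) (y.j ⊔ (y.z ⊔ y.c 0) ⊓ y.u 1),
    (y.j ⊓ y.u 0, y.b)]

/-- The equations for the operations occurring in `fs`. -/
def symbolEqs (fs : List (ℕ → ℕ)) : List (α × α) :=
  fs.map (fun f => leEq (y.F f) (y.u 0 ⊔ y.u 1)) ++
  fs.map (fun f => leEq (y.G f) (y.u 1 ⊔ y.u 2)) ++
  fs.map (fun f => (y.compGraph (y.G f) (y.c 0), y.compGraph (y.c 1) (y.F f)))

/-- The equations between compositions of operations. -/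
def relationEqs (E : List TrueEq) : List (α × α) :=
  E.map fun q => (y.compGraph (y.G q.1.1.1) (y.F q.1.1.2), y.compGraph (y.G q.1.2.1) (y.F q.1.2.2))

/-- All equations that do not depend on the instance. -/
def eqs (M : ℕ) (fs : List (ℕ → ℕ)) (E : List TrueEq) : List (α × α) :=
  y.chainEqs M ++ (y.frameEqs ++ (y.symbolEqs fs ++ y.relationEqs E))

/-- The equation stating that `Q` takes the value `1` at `n`. -/
def instanceEq (Q : ℕ → ℕ) (n : ℕ) : α × α :=
  (y.act Q ((y.act Nat.succ)^[n] y.z), y.act Nat.succ y.z)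

end Terms

section Lattice

variable {L : Type} [Lattice L] {y : Pattern L}

theorem leEq_iff {s t : L} : (leEq s t).1 = (leEq s t).2 ↔ s ≤ t := inf_eq_left

theorem act_mem_Icc (h0 : y.b ≤ y.u 0) (h1 : y.b ≤ y.u 1) (f : ℕ → ℕ) {p : L}
    (hp : p ∈ Set.Icc y.b (y.u 0)) : y.act f p ∈ Set.Icc y.b (y.u 0) :=
  ⟨le_inf (le_sup_of_le_left (le_inf (le_sup_of_le_left hp.1) h1)) h0, inf_le_right⟩

variable {M : ℕ} {fs : List (ℕ → ℕ)}

/-- If the base point is trivial, then so is every solution of the equations of a pattern. -/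
theorem x_eq_of_z_eq (hM : 2 ≤ M) {E : List TrueEq} (h : ∀ e ∈ y.eqs M fs E, e.1 = e.2)
    (hz : y.z = y.b) {i : ℕ} (hi : i < 5) : y.x i = y.b := by
  simp only [eqs, List.forall_mem_append, chainEqs, frameEqs,
    List.forall_mem_map, List.mem_range, leEq_iff, List.forall_mem_cons] at h
  obtain ⟨⟨⟨⟨hbx, hxu⟩, hucs⟩, hcus⟩,
    ⟨hb0, hb1, -, hc0, -, -, -, -, -, -, -, -, -, -, hj, hju, -⟩, -⟩ := h
  have hu0 : y.u 0 = y.b := by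
    have hbc : y.b ≤ y.c 0 := hc0 ▸ inf_le_left
    have hbj : y.b ≤ y.j := hju ▸ inf_le_left
    rw [hz, sup_eq_right.2 hbc, hcus 0 (by omega), sup_eq_left.2 hbj] at hj
    rw [← hju, inf_eq_right.2 hj]
  have hu : ∀ t ≤ M, y.u t = y.b := by
    intro t ht
    induction t with
    | zero => exact hu0
    | succ t ih =>
      have h1 := hucs t ht
      have h2 := hcus t ht
      have hbc : y.b ≤ y.c t := h2 ▸ inf_le_left
      rw [ih (by omega), sup_eq_right.2 hbc] at h1
      rw [← h2, inf_eq_right.2 h1]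
  have hjoin : ∀ t ≤ M, y.joinU t = y.b := by
    intro t ht
    induction t with
    | zero => exact hu0
    | succ t ih => rw [joinU, ih (by omega), hu _ ht, sup_idem]
  exact le_antisymm ((hxu i hi).trans_eq (hjoin M le_rfl)) (hbx i hi)

variable [IsModularLattice L]

/-- A perspectivity followed by its inverse is the identity. -/
theorem perspective_symm_apply {b s t c p : L} (hc : c ⊓ s = b) (hs : s ≤ t ⊔ c) (hbp : b ≤ p)
    (hp : p ≤ s) : ((p ⊔ c) ⊓ t ⊔ c) ⊓ s = p := by
  rw [inf_sup_assoc_of_le t (le_sup_right : c ≤ p ⊔ c), inf_assoc, inf_eq_right.2 hs,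
    sup_inf_assoc_of_le c hp, hc, sup_eq_left.2 hbp]

/-- The image under a composition of relations. -/
theorem image_image_eq {u₀ u₁ u₂ f g p : L} (hu : (u₀ ⊔ u₁) ⊓ (u₁ ⊔ u₂) = u₁) (hf : f ≤ u₁ ⊔ u₂)
    (hg : g ≤ u₀ ⊔ u₁) (hp : p ≤ u₀) :
    ((p ⊔ g) ⊓ u₁ ⊔ f) ⊓ u₂ = (p ⊔ (f ⊔ g) ⊓ (u₀ ⊔ u₂)) ⊓ u₂ := by
  have hq : p ⊔ g ≤ u₀ ⊔ u₁ := sup_le (le_sup_of_le_left hp) hg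
  have h1 : (p ⊔ g) ⊓ u₁ = (p ⊔ g) ⊓ (u₁ ⊔ u₂) := by
    conv_lhs => rw [← hu, ← inf_assoc, inf_eq_left.2 hq]
  have h2 : u₂ = (u₀ ⊔ u₂) ⊓ u₂ := (inf_eq_right.2 le_sup_right).symm
  have h3 : u₂ = (u₁ ⊔ u₂) ⊓ u₂ := (inf_eq_right.2 le_sup_right).symm
  have hl : ((p ⊔ g) ⊓ u₁ ⊔ f) ⊓ u₂ = (p ⊔ (f ⊔ g)) ⊓ u₂ := by
    rw [h1, sup_comm, ← sup_inf_assoc_of_le _ hf, inf_assoc, ← h3]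
    congr 1
    ac_rfl
  rw [hl, ← sup_inf_assoc_of_le _ (le_sup_of_le_left hp : p ≤ u₀ ⊔ u₂), inf_assoc, ← h2]

variable {E : Finset TrueEq}

/-- A solution of the equations of a pattern contains a unary algebra satisfying `E`. -/
theorem exists_unaryModel (hM : 2 ≤ M) (hfs : ∀ q ∈ E, q.1.1.1 ∈ fs ∧ q.1.1.2 ∈ fs ∧
    q.1.2.1 ∈ fs ∧ q.1.2.2 ∈ fs) (h : ∀ e ∈ y.eqs M fs E.toList, e.1 = e.2) :
    ∃ m : UnaryModel E (Set.Icc y.b (y.u 0)),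
      m.base.1 = y.z ∧ ∀ f p, (m.act f p).1 = y.act f p := by
  simp only [eqs, List.forall_mem_append, chainEqs, frameEqs, symbolEqs, relationEqs,
    List.forall_mem_map, List.mem_range, leEq_iff, List.forall_mem_cons, Finset.mem_toList] at h
  obtain ⟨⟨⟨-, hucs⟩, hcus⟩, ⟨hb0, hb1, hu, hc0, hu0, hc0', hc1, hu1, hc1', hid, hbz, hzu, hz0, -⟩,
    ⟨⟨hF, hG⟩, hFG⟩, hE⟩ := h
  have hc01 : y.c 0 ⊓ y.u 1 = y.b := hcus 0 (by omega)
  have hu10 : y.u 1 ≤ y.u 0 ⊔ y.c 0 := hucs 0 (by omega)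
  -- applying `f` after `g` and moving to `u 2` depends on the composed graph only
  have key : ∀ f ∈ fs, ∀ g ∈ fs, ∀ p ∈ Set.Icc y.b (y.u 0),
      y.act f (y.act g p) = ((((p ⊔ y.compGraph (y.G f) (y.F g)) ⊓ y.u 2 ⊔ y.c 1) ⊓ y.u 1) ⊔
        y.c 0) ⊓ y.u 0 := by
    intro f hf g hg p hp
    have hq := act_mem_Icc hb0 hb1 g hp
    have hx : y.b ≤ (p ⊔ y.F g) ⊓ y.u 1 := le_inf (le_sup_of_le_left hp.1) hb1
    have hxq : (y.act g p ⊔ y.c 0) ⊓ y.u 1 = (p ⊔ y.F g) ⊓ y.u 1 :=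
      perspective_symm_apply hc01 hu10 hx inf_le_right
    have e1 := image_image_eq hu (hG f hf) hc0' hq.2
    have e2 := image_image_eq hu hc1' (hF f hf) hq.2
    have e3 := image_image_eq hu (hG f hf) (hF g hg) hp.2
    have e4 := hFG f hf
    simp only [compGraph] at e4 ⊢
    rw [← e3, ← hxq, e1, e4, ← e2, perspective_symm_apply hc1 hu1
      (le_inf (le_sup_of_le_left hq.1) hb1) inf_le_right]
    rfl
  refine ⟨⟨fun f p => ⟨y.act f p.1, act_mem_Icc hb0 hb1 f p.2⟩, ⟨y.z, hbz, hzu⟩, ?_, ?_, ?_⟩,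
    rfl, fun _ _ => rfl⟩
  · rintro ⟨p, hp⟩
    refine Subtype.ext ?_
    simp only [act, hid]
    exact perspective_symm_apply hc0 hu0 hp.1 hp.2
  · exact Subtype.ext hz0
  · rintro q hq ⟨p, hp⟩
    obtain ⟨h1, h2, h3, h4⟩ := hfs q hq
    refine Subtype.ext ?_
    simp only [key _ h1 _ h2 p hp, key _ h3 _ h4 p hp, hE q hq]

/-- If `E` forces `Q` to take the value `0` at `n`, then the equations have only trivial
solutions. -/
theorem collapse (hM : 2 ≤ M) (hfs : ∀ q ∈ E, q.1.1.1 ∈ fs ∧ q.1.1.2 ∈ fs ∧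
    q.1.2.1 ∈ fs ∧ q.1.2.2 ∈ fs) (h : ∀ e ∈ y.eqs M fs E.toList, e.1 = e.2) {Q : ℕ → ℕ} {n : ℕ}
    (hQ : ∀ (P : Type) (m : UnaryModel E P), m.act Q (m.pt n) = m.pt 0)
    (hn : (y.instanceEq Q n).1 = (y.instanceEq Q n).2) {i : ℕ} (hi : i < 5) : y.x i = y.b := by
  obtain ⟨m, hbase, hact⟩ := exists_unaryModel hM hfs h
  have hpt : ∀ n, (m.pt n).1 = (y.act Nat.succ)^[n] y.z := by
    intro n
    induction n with
    | zero => exact hbase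
    | succ n ih => rw [← m.act_succ_pt, hact, ih, Function.iterate_succ_apply']
  have h1 : y.z = y.act Nat.succ y.z := by
    rw [← hbase, ← hact, hbase]
    have h2 := congrArg Subtype.val (hQ _ m)
    rw [hact, hpt, hpt] at h2
    simp only [instanceEq, h2] at hn
    rw [hact, hbase]
    exact hn
  refine x_eq_of_z_eq hM h ?_ hi
  simp only [eqs, List.forall_mem_append, frameEqs, List.forall_mem_cons] at h
  have h3 := h.2.1.2.2.2.2.2.2.2.2.2.2.2.2.2.1
  simpa [← h1] using h3

end Lattice

end Pattern

/-! ### Subspaces of a power of a module -/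

section Subspaces

variable {k V : Type} [Ring k] [AddCommGroup V] [Module k V]

/-- The vectors supported in `S`. -/
def supported (k V : Type) [Ring k] [AddCommGroup V] [Module k V] (S : Set ℕ) :
    Submodule k (ℕ → V) where
  carrier := {w | ∀ i ∉ S, w i = 0}
  add_mem' h h' i hi := by simp [h i hi, h' i hi]
  zero_mem' _ _ := rfl
  smul_mem' r _ h i hi := by simp [h i hi]

theorem mem_supported {S : Set ℕ} {w : ℕ → V} : w ∈ supported k V S ↔ ∀ i ∉ S, w i = 0 := Iff.rfl

theorem supported_inf (S T : Set ℕ) :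
    supported k V S ⊓ supported k V T = supported k V (S ∩ T) := by
  ext w
  simp only [Submodule.mem_inf, mem_supported, Set.mem_inter_iff]
  constructor
  · rintro ⟨h, h'⟩ i hi
    by_cases hS : i ∈ S
    · exact h' i fun hT => hi ⟨hS, hT⟩
    · exact h i hS
  · exact fun h => ⟨fun i hi => h i fun hi' => hi hi'.1, fun i hi => h i fun hi' => hi hi'.2⟩

theorem supported_sup (S T : Set ℕ) :
    supported k V S ⊔ supported k V T = supported k V (S ∪ T) := by
  classical
  refine le_antisymm (sup_le ?_ ?_) fun w hw => Submodule.mem_sup.2 ?_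
  · exact fun w hw i hi => hw i fun h => hi (Or.inl h)
  · exact fun w hw i hi => hw i fun h => hi (Or.inr h)
  · refine ⟨fun i => if i ∈ S then w i else 0, fun i hi => if_neg hi,
      fun i => if i ∈ S then 0 else w i, fun i hi => ?_, ?_⟩
    · by_cases hS : i ∈ S
      · exact if_pos hS
      · simpa [hS] using hw i (by simp [hS, hi])
    · ext i
      by_cases hS : i ∈ S <;> simp [hS]

/-- The vectors supported in `D` that change sign under `σ` on `D`. -/
def matching (k V : Type) [Ring k] [AddCommGroup V] [Module k V] (σ : ℕ → ℕ) (D : Set ℕ) :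
    Submodule k (ℕ → V) where
  carrier := {w | (∀ i ∉ D, w i = 0) ∧ ∀ i ∈ D, w (σ i) = -w i}
  add_mem' h h' := ⟨fun i hi => by simp [h.1 i hi, h'.1 i hi],
    fun i hi => by simp [h.2 i hi, h'.2 i hi, add_comm]⟩
  zero_mem' := ⟨fun _ _ => rfl, fun _ _ => by simp⟩
  smul_mem' r _ h := ⟨fun i hi => by simp [h.1 i hi], fun i hi => by simp [h.2 i hi]⟩

theorem supported_inf_sup_matching {σ : ℕ → ℕ} {D A T : Set ℕ} (hσ : ∀ i, σ (σ i) = i)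
    (hD : ∀ i ∈ D, σ i ∈ D) (hAT : ∀ i ∈ A, i ∉ T) (hT : ∀ i ∈ T, i ∈ D → σ i ∉ T) :
    supported k V T ⊓ (supported k V A ⊔ matching k V σ D) =
      supported k V {i | i ∈ T ∧ i ∈ D ∧ σ i ∈ A} := by
  refine le_antisymm ?_ fun w hw => ⟨fun i hi => hw i fun h => hi h.1, ?_⟩
  · rintro w ⟨hw, hw'⟩ i hi
    obtain ⟨a, ha, d, hd, rfl⟩ := Submodule.mem_sup.1 hw'
    by_cases hiT : i ∈ T
    · have hai : a i = 0 := ha i fun h => hAT i h hiT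
      by_cases hiD : i ∈ D
      · have h1 := hw (σ i) (hT i hiT hiD)
        have h2 : a (σ i) = 0 := ha _ fun h => hi ⟨hiT, hiD, h⟩
        simpa [hai, h2, hd.2 i hiD] using h1
      · simp [hai, hd.1 i hiD]
    · exact hw i hiT
  · refine Submodule.mem_sup.2 ⟨fun i => w (σ i), fun i hi => ?_, fun i => w i - w (σ i),
      ⟨fun i hi => ?_, fun i hi => ?_⟩, ?_⟩
    · exact hw (σ i) fun h => hi (hσ i ▸ h.2.2)
    · change w i - w (σ i) = 0
      rw [hw i fun h => hi h.2.1, hw (σ i) fun h => hi (hσ i ▸ hD _ h.2.1), sub_zero]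
    · simp [hσ]
    · ext i; simp

/-- The graph of `-R`, from the `i`-th to the `j`-th coordinate. -/
def graphAt (i j : ℕ) (R : V →ₗ[k] V) : Submodule k (ℕ → V) where
  carrier := {w | (∀ l, l ≠ i → l ≠ j → w l = 0) ∧ w j = -R (w i)}
  add_mem' h h' := ⟨fun l hi hj => by simp [h.1 l hi hj, h'.1 l hi hj],
    by simp [h.2, h'.2, add_comm]⟩
  zero_mem' := ⟨fun _ _ _ => rfl, by simp⟩
  smul_mem' r _ h := ⟨fun l hi hj => by simp [h.1 l hi hj], by simp [h.2]⟩

/-- A submodule placed in the `i`-th coordinate. -/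
def placeAt (i : ℕ) (p : Submodule k V) : Submodule k (ℕ → V) where
  carrier := {w | (∀ l, l ≠ i → w l = 0) ∧ w i ∈ p}
  add_mem' h h' := ⟨fun l hi => by simp [h.1 l hi, h'.1 l hi], p.add_mem h.2 h'.2⟩
  zero_mem' := ⟨fun _ _ => rfl, p.zero_mem⟩
  smul_mem' r _ h := ⟨fun l hi => by simp [h.1 l hi], p.smul_mem r h.2⟩

theorem graphAt_id_comm (i j : ℕ) :
    graphAt i j (LinearMap.id : V →ₗ[k] V) = graphAt j i LinearMap.id := by
  have h (i j : ℕ) : graphAt i j (LinearMap.id : V →ₗ[k] V) ≤ graphAt j i LinearMap.id :=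
    fun w hw => ⟨fun l hj hi => hw.1 l hi hj, by simpa using neg_eq_iff_eq_neg.2 hw.2 |>.symm⟩
  exact le_antisymm (h i j) (h j i)

theorem graphAt_le (i j : ℕ) (R : V →ₗ[k] V) :
    graphAt i j R ≤ supported k V {i} ⊔ supported k V {j} := by
  rw [supported_sup]
  exact fun w hw l hl => hw.1 l (fun h => hl (Or.inl h)) fun h => hl (Or.inr h)

theorem graphAt_comp {i j l : ℕ} (hij : i ≠ j) (hjl : j ≠ l) (hil : i ≠ l) (R S : V →ₗ[k] V) :
    (graphAt j l S ⊔ graphAt i j R) ⊓ (supported k V {i} ⊔ supported k V {l}) =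
      graphAt i l (S ∘ₗ R) := by
  rw [supported_sup]
  refine le_antisymm ?_ fun w hw => ⟨Submodule.mem_sup.2 ?_, ?_⟩
  · rintro w ⟨hw, hw'⟩
    obtain ⟨s, hs, r, hr, rfl⟩ := Submodule.mem_sup.1 hw
    refine ⟨fun t hi hl => hw' t (by simp [hi, hl]), ?_⟩
    have h1 := hw' j (by simp [hij.symm, hjl])
    have h2 : r l = 0 := hr.1 l hil.symm hjl.symm
    have h3 : s i = 0 := hs.1 i hij hil
    have h4 : s j = -r j := eq_neg_of_add_eq_zero_left h1
    simp [h2, h3, hs.2, h4, hr.2]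
  · refine ⟨fun t => if t = j then R (w i) else if t = l then w l else 0, ⟨?_, ?_⟩,
      fun t => if t = i then w i else if t = j then -R (w i) else 0, ⟨?_, ?_⟩, ?_⟩
    · exact fun t hj hl => by simp [hj, hl]
    · simp [hjl.symm, hw.2]
    · exact fun t hi hj => by simp [hi, hj]
    · simp [hij.symm]
    · ext t
      by_cases hi : t = i
      · subst hi; simp [hij, hil]
      by_cases hj : t = j
      · subst hj; simp [hi, hw.1 t hi hjl]
      by_cases hl : t = l
      · subst hl; simp [hi, hj]
      simp [hi, hj, hl, hw.1 t hi hl]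
  · exact fun t ht => hw.1 t (fun h => ht (Or.inl h)) fun h => ht (Or.inr h)

theorem placeAt_image {i j : ℕ} (hij : i ≠ j) (R : V →ₗ[k] V) (p : Submodule k V) :
    (placeAt i p ⊔ graphAt i j R) ⊓ supported k V {j} = placeAt j (p.map R) := by
  refine le_antisymm ?_ fun w hw => ⟨Submodule.mem_sup.2 ?_, fun t ht => hw.1 t ht⟩
  · rintro w ⟨hw, hw'⟩
    obtain ⟨s, hs, r, hr, rfl⟩ := Submodule.mem_sup.1 hw
    refine ⟨fun t ht => hw' t ht, s i, hs.2, ?_⟩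
    have h1 : r i = -s i := eq_neg_of_add_eq_zero_right (hw' i hij)
    have h2 : s j = 0 := hs.1 j hij.symm
    simp [h2, hr.2, h1]
  · obtain ⟨v, hv, hvw⟩ := hw.2
    refine ⟨Pi.single i v, ⟨fun t ht => by simp [ht], by simpa using hv⟩,
      w - Pi.single i v, ⟨fun t hi hj => by simp [hi, hw.1 t hj], ?_⟩, by simp⟩
    simp [hij.symm, hw.1 i hij, hvw]

theorem placeAt_le (i : ℕ) (p : Submodule k V) : placeAt i p ≤ supported k V {i} :=
  fun _ hw => hw.1

theorem graphAt_inf_source {i j : ℕ} (R : V →ₗ[k] V)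
    (hR : Function.Injective R) (hij : i ≠ j) : graphAt i j R ⊓ supported k V {i} = ⊥ := by
  refine eq_bot_iff.2 fun w ⟨hw, hw'⟩ => ?_
  have h1 : w i = 0 := hR (by rw [map_zero, ← neg_eq_zero, ← hw.2]; exact hw' j hij.symm)
  ext t
  by_cases hi : t = i
  · rw [hi, h1]; rfl
  · exact hw' t hi

theorem graphAt_inf_target {i j : ℕ} (R : V →ₗ[k] V) (hij : i ≠ j) :
    graphAt i j R ⊓ supported k V {j} = ⊥ := by
  refine eq_bot_iff.2 fun w ⟨hw, hw'⟩ => ?_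
  ext t
  by_cases hj : t = j
  · rw [hj, hw.2, hw' i hij, map_zero, neg_zero]; rfl
  · exact hw' t hj

theorem supported_le_graphAt_sup {i j : ℕ} (R : V →ₗ[k] V) (hij : i ≠ j) :
    supported k V {i} ≤ graphAt i j R ⊔ placeAt j (LinearMap.range R) := by
  refine fun w hw => Submodule.mem_sup.2 ⟨w - Pi.single j (R (w i)),
    ⟨fun t hi hj => by simp [hj, hw t hi], ?_⟩, Pi.single j (R (w i)),
    ⟨fun t ht => by simp [ht], by simp⟩, by simp⟩
  simp [hij, hw j hij.symm]

end Subspaces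

/-! ### Five generating subspaces -/

/-- The elements that are values of lattice terms in the first five variables. -/
def Generated {L : Type} [Lattice L] (v : ℕ → L) (a : L) : Prop :=
  ∃ t : LatTerm, t.vars ⊆ Finset.range 5 ∧ t.eval v = a

namespace Generated

variable {L : Type} [Lattice L] {v : ℕ → L} {a b : L}

theorem var {i : ℕ} (hi : i < 5) : Generated v (v i) :=
  ⟨.var i, by simpa [LatTerm.vars] using hi, rfl⟩

theorem sup (ha : Generated v a) (hb : Generated v b) : Generated v (a ⊔ b) := by
  obtain ⟨s, hs, rfl⟩ := ha
  obtain ⟨t, ht, rfl⟩ := hb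
  exact ⟨.sup s t, Finset.union_subset hs ht, rfl⟩

theorem inf (ha : Generated v a) (hb : Generated v b) : Generated v (a ⊓ b) := by
  obtain ⟨s, hs, rfl⟩ := ha
  obtain ⟨t, ht, rfl⟩ := hb
  exact ⟨.inf s t, Finset.union_subset hs ht, rfl⟩

end Generated

/-- The involution exchanging `2 * i` and `2 * i + 1`. -/
def swapEven (i : ℕ) : ℕ := if i % 2 = 0 then i + 1 else i - 1

/-- The involution fixing `0` and exchanging `2 * i + 1` and `2 * i + 2`. -/
def swapOdd (i : ℕ) : ℕ := if i % 2 = 1 then i + 1 else i - 1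

theorem swapEven_swapEven (i : ℕ) : swapEven (swapEven i) = i := by
  unfold swapEven; grind

theorem swapOdd_swapOdd (i : ℕ) : swapOdd (swapOdd i) = i := by
  unfold swapOdd; grind

section FiveSubspaces

variable {k V : Type} [Ring k] [AddCommGroup V] [Module k V]

/-- The submodule holding a submodule `p` and the graphs of `R 0, …, R (N - 1)` in separate
coordinates. -/
def storage (p : Submodule k V) (R : ℕ → V →ₗ[k] V) (N : ℕ) : Submodule k (ℕ → V) where
  carrier := {w | w 0 ∈ p ∧ (∀ i < N, w (2 * i + 5) = -R i (w (2 * i + 4))) ∧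
    ∀ t, 0 < t ∧ t < 4 ∨ 2 * N + 4 ≤ t → w t = 0}
  add_mem' h h' := ⟨p.add_mem h.1 h'.1, fun i hi => by simp [h.2.1 i hi, h'.2.1 i hi, add_comm],
    fun t ht => by simp [h.2.2 t ht, h'.2.2 t ht]⟩
  zero_mem' := ⟨p.zero_mem, fun _ _ => by simp, fun _ _ => rfl⟩
  smul_mem' r _ h := ⟨p.smul_mem r h.1, fun i hi => by simp [h.2.1 i hi],
    fun t ht => by simp [h.2.2 t ht]⟩

/-- Five submodules of `ℕ → V` that generate `p`, the graphs of `R 0, …, R (N - 1)` and the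
coordinate submodules up to `2 * N + 4`. -/
def fiveSubspaces (p : Submodule k V) (R : ℕ → V →ₗ[k] V) (N : ℕ) : ℕ → Submodule k (ℕ → V)
  | 0 => supported k V {i | i % 2 = 0 ∧ i ≤ 2 * N + 4}
  | 1 => supported k V {i | i % 2 = 1 ∧ i ≤ 2 * N + 4}
  | 2 => matching k V swapEven {i | i < 2 * N + 4}
  | 3 => matching k V swapOdd {i | 0 < i ∧ i ≤ 2 * N + 4}
  | 4 => storage p R N
  | _ => ⊥

variable {p : Submodule k V} {R : ℕ → V →ₗ[k] V} {N : ℕ}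

/-- One step along the chain of coordinates. -/
theorem generated_supported_step {A B : Set ℕ} {r : ℕ}
    (hA : Generated (fiveSubspaces p R N) (supported k V A))
    (hAr : ∀ i ∈ A, i % 2 ≠ r % 2)
    (hB : (∀ i, i ∈ B ↔ i % 2 = r % 2 ∧ i < 2 * N + 4 ∧ swapEven i ∈ A) ∨
      ∀ i, i ∈ B ↔ i % 2 = r % 2 ∧ 0 < i ∧ i ≤ 2 * N + 4 ∧ swapOdd i ∈ A) :
    Generated (fiveSubspaces p R N) (supported k V B) := by
  have hT : Generated (fiveSubspaces p R N)
      (supported k V {i | i % 2 = r % 2 ∧ i ≤ 2 * N + 4}) := by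
    obtain h | h := Nat.mod_two_eq_zero_or_one r
    · rw [h]; exact Generated.var (i := 0) (by norm_num)
    · rw [h]; exact Generated.var (i := 1) (by norm_num)
  rcases hB with hB | hB
  · convert hT.inf (hA.sup (Generated.var (i := 2) (by norm_num))) using 1
    refine Eq.trans ?_ (supported_inf_sup_matching swapEven_swapEven ?_ ?_ ?_).symm
    · congr 1; ext i; rw [hB]
      simp only [Set.mem_ofPred_eq]
      constructor
      · rintro ⟨h1, h2, h3⟩; exact ⟨⟨h1, h2.le⟩, h2, h3⟩
      · rintro ⟨⟨h1, -⟩, h2, h3⟩; exact ⟨h1, h2, h3⟩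
    · intro i hi; simp only [swapEven, Set.mem_ofPred_eq] at *; grind
    · exact fun i hi h => hAr i hi h.1
    · rintro i ⟨hi, -⟩ hi' ⟨h, -⟩; simp only [swapEven, Set.mem_ofPred_eq] at *; grind
  · convert hT.inf (hA.sup (Generated.var (i := 3) (by norm_num))) using 1
    refine Eq.trans ?_ (supported_inf_sup_matching swapOdd_swapOdd ?_ ?_ ?_).symm
    · congr 1; ext i; rw [hB]
      simp only [Set.mem_ofPred_eq]
      constructor
      · rintro ⟨h1, h0, h2, h3⟩; exact ⟨⟨h1, h2⟩, ⟨h0, h2⟩, h3⟩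
      · rintro ⟨⟨h1, -⟩, ⟨h0, h2⟩, h3⟩; exact ⟨h1, h0, h2, h3⟩
    · intro i hi; simp only [swapOdd, Set.mem_ofPred_eq] at *; grind
    · exact fun i hi h => hAr i hi h.1
    · rintro i ⟨hi, -⟩ ⟨hi0, hi'⟩ ⟨h, -⟩; simp only [swapOdd] at *; grind

theorem generated_supported_tail {t : ℕ} (ht : t ≤ 2 * N + 4) :
    Generated (fiveSubspaces p R N)
      (supported k V {i | i % 2 = t % 2 ∧ t ≤ i ∧ i ≤ 2 * N + 4}) := by
  induction t with
  | zero =>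
    simpa [fiveSubspaces] using Generated.var (v := fiveSubspaces p R N) (i := 0) (by norm_num)
  | succ t ih =>
    refine generated_supported_step (r := t + 1) (ih (by omega)) (fun i hi => ?_) ?_
    · have := hi.1; omega
    · simp only [swapEven, swapOdd, Set.mem_ofPred_eq]
      obtain h | h := Nat.mod_two_eq_zero_or_one t
      · left; intro i; grind
      · right; intro i; grind

theorem generated_supported_head {t s : ℕ} (hts : t + s = 2 * N + 4) :
    Generated (fiveSubspaces p R N) (supported k V {i | i % 2 = t % 2 ∧ i ≤ t}) := by
  induction s generalizing t with
  | zero =>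
    have ht : t % 2 = 0 := by omega
    rw [ht, show t = 2 * N + 4 by omega]
    exact Generated.var (i := 0) (by norm_num)
  | succ s ih =>
    refine generated_supported_step (r := t) (ih (t := t + 1) (by omega)) (fun i hi => ?_) ?_
    · have := hi.1; omega
    · simp only [swapEven, swapOdd, Set.mem_ofPred_eq]
      obtain h | h := Nat.mod_two_eq_zero_or_one t
      · left; intro i; grind
      · right; intro i; grind

theorem generated_coordinate {t : ℕ} (ht : t ≤ 2 * N + 4) :
    Generated (fiveSubspaces p R N) (supported k V {t}) := by
  have h := (generated_supported_tail (p := p) (R := R) ht).inf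
    (generated_supported_head (Nat.add_sub_cancel' ht))
  rw [supported_inf] at h
  convert h using 2
  ext i
  simp only [Set.mem_singleton_iff, Set.mem_inter_iff, Set.mem_ofPred_eq]
  omega

theorem matching_inf_supported {σ : ℕ → ℕ} {D : Set ℕ} {i j : ℕ} (hi : i ∈ D) (hj : j ∈ D)
    (hij : σ i = j) (hji : σ j = i) (hσ : ∀ l, l ≠ i → l ≠ j → σ l ≠ i ∧ σ l ≠ j) :
    matching k V σ D ⊓ (supported k V {i} ⊔ supported k V {j}) = graphAt i j LinearMap.id := by
  rw [supported_sup]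
  refine le_antisymm ?_ fun w hw => ⟨⟨fun l hl => ?_, fun l hl => ?_⟩, fun l hl => ?_⟩
  · rintro w ⟨hw, hw'⟩
    exact ⟨fun l hli hlj => hw' l (by simp [hli, hlj]), by simpa [hij] using hw.2 i hi⟩
  · exact hw.1 l (fun h => hl (h ▸ hi)) fun h => hl (h ▸ hj)
  · by_cases hli : l = i
    · subst hli; simpa [hij] using hw.2
    by_cases hlj : l = j
    · subst hlj; simpa [hji] using (neg_eq_iff_eq_neg.2 hw.2).symm
    obtain ⟨h1, h2⟩ := hσ l hli hlj
    rw [hw.1 _ h1 h2, hw.1 _ hli hlj, neg_zero]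
  · exact hw.1 l (fun h => hl (Or.inl h)) fun h => hl (Or.inr h)

theorem generated_graphAt_succ {t : ℕ} (ht : t < 2 * N + 4) :
    Generated (fiveSubspaces p R N) (graphAt t (t + 1) (LinearMap.id : V →ₗ[k] V)) := by
  have hu := (generated_coordinate (p := p) (R := R) ht.le).sup
    (generated_coordinate (N := N) (t := t + 1) (by omega))
  obtain h | h := Nat.mod_two_eq_zero_or_one t
  · convert (Generated.var (i := 2) (by norm_num)).inf hu using 1
    refine (matching_inf_supported ?_ ?_ ?_ ?_ fun l hl hl' => ?_).symm <;>
      simp only [swapEven, Set.mem_ofPred_eq] <;> grind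
  · convert (Generated.var (i := 3) (by norm_num)).inf hu using 1
    refine (matching_inf_supported ?_ ?_ ?_ ?_ fun l hl hl' => ?_).symm <;>
      simp only [swapOdd, Set.mem_ofPred_eq] <;> grind

theorem Generated.graphAt_comp {i j l : ℕ} (hi : i ≤ 2 * N + 4) (hl : l ≤ 2 * N + 4)
    (hij : i ≠ j) (hjl : j ≠ l) (hil : i ≠ l) {S T : V →ₗ[k] V}
    (hS : Generated (fiveSubspaces p R N) (graphAt i j S))
    (hT : Generated (fiveSubspaces p R N) (graphAt j l T)) :
    Generated (fiveSubspaces p R N) (graphAt i l (T ∘ₗ S)) := by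
  rw [← _root_.graphAt_comp hij hjl hil]
  exact (hT.sup hS).inf ((generated_coordinate hi).sup (generated_coordinate hl))

theorem generated_graphAt_id {i j : ℕ} (hi : i ≤ 2 * N + 4) (hj : j ≤ 2 * N + 4) (hij : i ≠ j) :
    Generated (fiveSubspaces p R N) (graphAt i j (LinearMap.id : V →ₗ[k] V)) := by
  have main : ∀ s i, i + (s + 1) ≤ 2 * N + 4 → Generated (fiveSubspaces p R N)
      (graphAt i (i + (s + 1)) (LinearMap.id : V →ₗ[k] V)) := by
    intro s i
    induction s with
    | zero => exact fun h => generated_graphAt_succ h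
    | succ s ih =>
      intro h
      exact Generated.graphAt_comp (by omega) h (by omega) (by omega) (by omega)
        (ih (by omega)) (generated_graphAt_succ (by omega))
  obtain h | h := lt_or_gt_of_ne hij
  · obtain ⟨s, rfl⟩ := Nat.exists_eq_add_of_lt h
    exact main s i hj
  · obtain ⟨s, rfl⟩ := Nat.exists_eq_add_of_lt h
    rw [graphAt_id_comm]
    exact main s j hi

theorem generated_graphAt_storage {i : ℕ} (hi : i < N) :
    Generated (fiveSubspaces p R N) (graphAt (2 * i + 4) (2 * i + 5) (R i)) := by
  convert (Generated.var (v := fiveSubspaces p R N) (i := 4) (by norm_num)).inf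
    ((generated_coordinate (t := 2 * i + 4) (by omega)).sup
      (generated_coordinate (t := 2 * i + 5) (by omega))) using 1
  rw [supported_sup]
  refine le_antisymm (fun w hw => ⟨⟨?_, fun l hl => ?_, fun t ht => ?_⟩, fun l hl => ?_⟩) ?_
  · rintro w ⟨hw, hw'⟩
    exact ⟨fun l h h' => hw' l (by simp [h, h']), hw.2.1 i hi⟩
  · rw [hw.1 0 (by omega) (by omega)]; exact p.zero_mem
  · by_cases hli : l = i
    · subst hli; exact hw.2
    · rw [hw.1 _ (by omega) (by omega), hw.1 (2 * l + 4) (by omega) (by omega), map_zero, neg_zero]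
  · exact hw.1 t (by omega) (by omega)
  · exact hw.1 l (fun h => hl (Or.inl h)) fun h => hl (Or.inr h)

theorem generated_graphAt {i a b : ℕ} (hi : i < N) (ha : a < 4) (hb : b < 4) (hab : a ≠ b) :
    Generated (fiveSubspaces p R N) (graphAt a b (R i)) :=
  Generated.graphAt_comp (by omega) (by omega) (j := 2 * i + 5) (by omega) (by omega) hab
    (Generated.graphAt_comp (by omega) (by omega) (j := 2 * i + 4) (by omega) (by omega) (by omega)
      (generated_graphAt_id (by omega) (by omega) (by omega)) (generated_graphAt_storage hi))
    (generated_graphAt_id (by omega) (by omega) (by omega))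

theorem generated_placeAt : Generated (fiveSubspaces p R N) (placeAt 0 p) := by
  convert (Generated.var (v := fiveSubspaces p R N) (i := 4) (by norm_num)).inf
    (generated_coordinate (t := 0) (by omega)) using 1
  refine le_antisymm (fun w hw => ⟨⟨hw.2, fun l hl => ?_, fun t ht => ?_⟩, hw.1⟩) ?_
  · exact fun w hw => ⟨hw.2, hw.1.1⟩
  · rw [hw.1 _ (by omega), hw.1 (2 * l + 4) (by omega), map_zero, neg_zero]
  · exact hw.1 t (by omega)

theorem generated_bot : Generated (fiveSubspaces p R N) ⊥ := by
  have h := (generated_coordinate (p := p) (R := R) (N := N) (t := 0) (by omega)).inf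
    (generated_coordinate (t := 1) (by omega))
  rw [supported_inf] at h
  convert h using 1
  refine (eq_bot_iff.2 fun w hw => funext fun i => hw i ?_).symm
  rintro ⟨rfl, h⟩
  exact absurd h (by simp)

theorem fiveSubspaces_le (i : ℕ) :
    fiveSubspaces p R N i ≤ supported k V {l | l ≤ 2 * N + 4} := by
  intro w hw l hl
  have hl' : 2 * N + 4 < l := not_le.1 hl
  match i, hw with
  | 0, hw => exact hw l fun h => hl h.2
  | 1, hw => exact hw l fun h => hl h.2
  | 2, hw => exact hw.1 l fun h : l < 2 * N + 4 => hl h.le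
  | 3, hw => exact hw.1 l fun h => hl h.2
  | 4, hw => exact hw.2.2 l (Or.inr hl'.le)
  | _ + 5, hw => rw [(Submodule.mem_bot k).1 hw]; rfl

end FiveSubspaces

/-! ### The standard solution -/

/-- The space on which operations on the natural numbers act via the first index. -/
abbrev OpSpace : Type := ℕ × ℕ →₀ ℚ

/-- The linear map induced by a function on the natural numbers. -/
noncomputable def opMap (f : ℕ → ℕ) : OpSpace →ₗ[ℚ] OpSpace :=
  Finsupp.lmapDomain ℚ ℚ (Prod.map f id)

/-- The subspace representing a natural number. -/
noncomputable def level (n : ℕ) : Submodule ℚ OpSpace := Finsupp.supported ℚ ℚ {i | i.1 = n}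

/-- An embedding of the whole space into the subspace representing `0`. -/
noncomputable def embedLevel : OpSpace →ₗ[ℚ] OpSpace :=
  Finsupp.lmapDomain ℚ ℚ fun i => (0, Nat.pair i.1 i.2)

theorem opMap_id : opMap id = LinearMap.id := Finsupp.lmapDomain_id _ _

theorem opMap_comp (f g : ℕ → ℕ) : opMap f ∘ₗ opMap g = opMap (f ∘ g) := by
  rw [opMap, opMap, ← Finsupp.lmapDomain_comp, Prod.map_comp_map]
  rfl

theorem map_level (f : ℕ → ℕ) (n : ℕ) : (level n).map (opMap f) = level (f n) := by
  rw [level, opMap, Finsupp.lmapDomain_supported, level]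
  congr 1
  ext ⟨a, b⟩
  constructor
  · rintro ⟨⟨a', b'⟩, rfl, h⟩
    simp_all
  · rintro rfl
    exact ⟨(n, b), rfl, rfl⟩

theorem level_inf_level {m n : ℕ} (h : m ≠ n) : level m ⊓ level n = ⊥ :=
  (Finsupp.disjoint_supported_supported
    (Set.disjoint_left.2 fun _ h1 h2 => h (h1.symm.trans h2))).eq_bot

theorem embedLevel_injective : Function.Injective embedLevel := by
  refine Finsupp.mapDomain_injective fun i j h => ?_
  have h2 := Nat.pair_eq_pair.1 (Prod.ext_iff.1 h).2
  exact Prod.ext h2.1 h2.2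

theorem range_embedLevel_le : LinearMap.range embedLevel ≤ level 0 := by
  rw [LinearMap.range_eq_map, ← Finsupp.supported_univ, embedLevel, Finsupp.lmapDomain_supported]
  refine Finsupp.supported_mono ?_
  rintro _ ⟨i, -, rfl⟩
  rfl

/-- The maps stored in the five subspaces. -/
noncomputable def storedMap (fs : List (ℕ → ℕ)) : ℕ → OpSpace →ₗ[ℚ] OpSpace
  | 0 => embedLevel
  | i + 1 => opMap (fs.getD i id)

/-- The five subspaces of the standard solution. -/
noncomputable def standardGenerators (fs : List (ℕ → ℕ)) : ℕ → Submodule ℚ (ℕ → OpSpace) :=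
  fiveSubspaces (level 0) (storedMap fs) (fs.length + 1)

/-- The length of the chain in the standard solution. -/
def chainLength (fs : List (ℕ → ℕ)) : ℕ := 2 * (fs.length + 1) + 4

/-- A pattern whose relevant entries are those of the standard solution. -/
structure IsStandard (fs : List (ℕ → ℕ)) (y : Pattern (Submodule ℚ (ℕ → OpSpace))) : Prop where
  x : ∀ i < 5, y.x i = standardGenerators fs i
  b : y.b = ⊥
  u : ∀ t ≤ chainLength fs, y.u t = supported ℚ OpSpace {t}
  c : ∀ t < chainLength fs, y.c t = graphAt t (t + 1) LinearMap.id
  z : y.z = placeAt 0 (level 0)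
  j : y.j = graphAt 0 1 embedLevel
  F : ∀ f ∈ fs, y.F f = graphAt 0 1 (opMap f)
  G : ∀ f ∈ fs, y.G f = graphAt 1 2 (opMap f)

namespace IsStandard

variable {fs : List (ℕ → ℕ)} {y : Pattern (Submodule ℚ (ℕ → OpSpace))}

theorem act_placeAt (h : IsStandard fs y) {f : ℕ → ℕ} (hf : f ∈ fs) (n : ℕ) :
    y.act f (placeAt 0 (level n)) = placeAt 0 (level (f n)) := by
  have hc0 : y.c 0 = graphAt 0 1 LinearMap.id := h.c 0 (by simp [chainLength])
  rw [Pattern.act, h.F f hf, h.u 0 (by simp [chainLength]), h.u 1 (by simp [chainLength]),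
    hc0, placeAt_image zero_ne_one, graphAt_id_comm,
    placeAt_image one_ne_zero, map_level, Submodule.map_id]

theorem joinU_eq (h : IsStandard fs y) {t : ℕ} (ht : t ≤ chainLength fs) :
    y.joinU t = supported ℚ OpSpace {l | l ≤ t} := by
  induction t with
  | zero => rw [Pattern.joinU, h.u 0 ht]; congr 1; ext; simp
  | succ t ih =>
    rw [Pattern.joinU, ih (by omega), h.u _ ht, supported_sup]
    congr 1; ext i
    simp only [Set.mem_union, Set.mem_ofPred_eq, Set.mem_singleton_iff]
    omega

theorem sat_chainEqs (h : IsStandard fs y) : ∀ e ∈ y.chainEqs (chainLength fs), e.1 = e.2 := by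
  simp only [Pattern.chainEqs, List.forall_mem_append, List.forall_mem_map, List.mem_range,
    Pattern.leEq_iff, h.b, bot_le, implies_true, true_and]
  refine ⟨⟨fun i hi => ?_, fun t ht => ?_⟩, fun t ht => ?_⟩
  · rw [h.x i hi, h.joinU_eq le_rfl]
    exact fiveSubspaces_le i
  · rw [h.u t ht.le, h.u (t + 1) ht, h.c t ht, sup_comm, graphAt_id_comm]
    refine (supported_le_graphAt_sup (i := t + 1) (j := t) LinearMap.id (by omega)).trans ?_
    exact sup_le_sup le_rfl (placeAt_le _ _)
  · rw [h.u (t + 1) ht, h.c t ht]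
    exact graphAt_inf_target _ (by omega)

theorem sat_frameEqs (h : IsStandard fs y) (hid : id ∈ fs) (h0 : (fun _ => 0) ∈ fs)
    (hs : Nat.succ ∈ fs) : ∀ e ∈ y.frameEqs, e.1 = e.2 := by
  have hu0 := h.u 0 (by simp [chainLength])
  have hu1 := h.u 1 (by simp [chainLength])
  have hu2 := h.u 2 (by simp [chainLength])
  have hc0 : y.c 0 = graphAt 0 1 LinearMap.id := h.c 0 (by simp [chainLength])
  have hc1 : y.c 1 = graphAt 1 2 LinearMap.id := h.c 1 (by simp [chainLength])
  have hle (i j : ℕ) (hij : i ≠ j) : supported ℚ OpSpace {i} ≤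
      supported ℚ OpSpace {j} ⊔ graphAt i j LinearMap.id := by
    rw [sup_comm]
    exact (supported_le_graphAt_sup LinearMap.id hij).trans (sup_le_sup le_rfl (placeAt_le _ _))
  have hz0 : y.act (fun _ => 0) y.z = y.z := by rw [h.z, h.act_placeAt h0]
  simp only [Pattern.frameEqs, List.forall_mem_cons, Pattern.leEq_iff, h.b, bot_le, true_and,
    List.not_mem_nil, false_implies, implies_true, and_true, hz0]
  rw [h.z, h.act_placeAt hs, h.F id hid, h.j, hu0, hu1, hu2, hc0, hc1, opMap_id]
  refine ⟨?_, graphAt_inf_source _ Function.injective_id (by decide), hle 0 1 (by decide),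
    graphAt_le _ _ _, graphAt_inf_source _ Function.injective_id (by decide), hle 1 2 (by decide),
    graphAt_le _ _ _, rfl, placeAt_le _ _, ?_, ?_,
    graphAt_inf_source _ embedLevel_injective (by decide)⟩
  · rw [supported_sup, supported_sup, supported_inf]
    congr 1; ext i
    simp only [Set.mem_union, Set.mem_inter_iff, Set.mem_singleton_iff]
    omega
  · refine eq_bot_iff.2 fun w hw => funext fun t => ?_
    by_cases ht : t = 0
    · have hw0 : w 0 ∈ level 0 ⊓ level (Nat.succ 0) := ⟨hw.1.2, hw.2.2⟩
      rw [level_inf_level (by decide)] at hw0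
      exact ht ▸ (Submodule.mem_bot ℚ).1 hw0
    · exact hw.1.1 t ht
  · rw [placeAt_image zero_ne_one, Submodule.map_id]
    refine (supported_le_graphAt_sup embedLevel zero_ne_one).trans (sup_le_sup le_rfl ?_)
    exact fun w hw => ⟨hw.1, range_embedLevel_le hw.2⟩

theorem sat_symbolEqs (h : IsStandard fs y) : ∀ e ∈ y.symbolEqs fs, e.1 = e.2 := by
  simp only [Pattern.symbolEqs, List.forall_mem_append, List.forall_mem_map, Pattern.leEq_iff,
    Pattern.compGraph, h.u 0 (by simp [chainLength]), h.u 1 (by simp [chainLength]),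
    h.u 2 (by simp [chainLength]), h.c 0 (by simp [chainLength]), h.c 1 (by simp [chainLength])]
  refine ⟨⟨fun f hf => ?_, fun f hf => ?_⟩, fun f hf => ?_⟩
  · rw [h.F f hf]; exact graphAt_le _ _ _
  · rw [h.G f hf]; exact graphAt_le _ _ _
  · rw [h.F f hf, h.G f hf, graphAt_comp (by decide) (by decide) (by decide),
      graphAt_comp (by decide) (by decide) (by decide)]
    rfl

theorem sat_relationEqs (h : IsStandard fs y) {E : List TrueEq} (hfs : ∀ q ∈ E, q.1.1.1 ∈ fs ∧
    q.1.1.2 ∈ fs ∧ q.1.2.1 ∈ fs ∧ q.1.2.2 ∈ fs) : ∀ e ∈ y.relationEqs E, e.1 = e.2 := by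
  simp only [Pattern.relationEqs, List.forall_mem_map, Pattern.compGraph,
    h.u 0 (by simp [chainLength]), h.u 2 (by simp [chainLength])]
  intro q hq
  obtain ⟨h1, h2, h3, h4⟩ := hfs q hq
  rw [h.G _ h1, h.F _ h2, h.G _ h3, h.F _ h4, graphAt_comp (by decide) (by decide) (by decide),
    graphAt_comp (by decide) (by decide) (by decide), opMap_comp, opMap_comp, q.2]

theorem sat_instanceEq (h : IsStandard fs y) (hs : Nat.succ ∈ fs) {Q : ℕ → ℕ} (hQ : Q ∈ fs)
    {n : ℕ} (hn : Q n = 1) : (y.instanceEq Q n).1 = (y.instanceEq Q n).2 := by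
  have hpt : (y.act Nat.succ)^[n] y.z = placeAt 0 (level n) := by
    clear hn
    induction n with
    | zero => exact h.z
    | succ n ih => rw [Function.iterate_succ_apply', ih, h.act_placeAt hs]
  simp only [Pattern.instanceEq]
  rw [hpt, h.act_placeAt hQ, hn, h.z, h.act_placeAt hs]

end IsStandard

/-! ### Patterns of terms -/

/-- Lattice terms in the first five variables. -/
abbrev FiveTerm : Type := {t : LatTerm // t.vars ⊆ Finset.range 5}

instance : Max FiveTerm := ⟨fun s t => ⟨.sup s.1 t.1, Finset.union_subset s.2 t.2⟩⟩

instance : Min FiveTerm := ⟨fun s t => ⟨.inf s.1 t.1, Finset.union_subset s.2 t.2⟩⟩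

namespace Pattern

section Map

variable {α β : Type*} [Max α] [Max β] {φ : α → β}

theorem map_joinU (hsup : ∀ a b, φ (a ⊔ b) = φ a ⊔ φ b) (y : Pattern α) (t : ℕ) :
    φ (y.joinU t) = (y.map φ).joinU t := by
  induction t with
  | zero => rfl
  | succ t ih => rw [joinU, joinU, hsup, ih]; rfl

variable [Min α] [Min β]

theorem map_act (hsup : ∀ a b, φ (a ⊔ b) = φ a ⊔ φ b) (hinf : ∀ a b, φ (a ⊓ b) = φ a ⊓ φ b)
    (y : Pattern α) (f : ℕ → ℕ) (p : α) : φ (y.act f p) = (y.map φ).act f (φ p) := by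
  simp only [act, map, hsup, hinf]

theorem map_eqs (hsup : ∀ a b, φ (a ⊔ b) = φ a ⊔ φ b) (hinf : ∀ a b, φ (a ⊓ b) = φ a ⊓ φ b)
    (y : Pattern α) (M : ℕ) (fs : List (ℕ → ℕ)) (E : List TrueEq) :
    (y.eqs M fs E).map (Prod.map φ φ) = (y.map φ).eqs M fs E := by
  simp only [eqs, chainEqs, frameEqs, symbolEqs, relationEqs, leEq, compGraph, List.map_append,
    List.map_map, List.map_cons, List.map_nil, Function.comp_def, Prod.map, hsup, hinf,
    map_act hsup hinf, map_joinU hsup]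
  rfl

theorem map_instanceEq (hsup : ∀ a b, φ (a ⊔ b) = φ a ⊔ φ b)
    (hinf : ∀ a b, φ (a ⊓ b) = φ a ⊓ φ b) (y : Pattern α) (Q : ℕ → ℕ) (n : ℕ) :
    Prod.map φ φ (y.instanceEq Q n) = (y.map φ).instanceEq Q n := by
  have h := (show Function.Semiconj φ (y.act Nat.succ) ((y.map φ).act Nat.succ) from
    map_act hsup hinf y Nat.succ).iterate_right n y.z
  simp only [instanceEq, Prod.map, map_act hsup hinf, h]
  rfl

end Map

/-- The conjunction of lattice equations describing the instance `n`. -/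
def conj (y : Pattern FiveTerm) (M : ℕ) (fs : List (ℕ → ℕ)) (E : List TrueEq) (Q : ℕ → ℕ)
    (n : ℕ) : LatConj :=
  (y.instanceEq Q n :: y.eqs M fs E).map (Prod.map Subtype.val Subtype.val)

variable (y : Pattern FiveTerm) (M : ℕ) (fs : List (ℕ → ℕ)) (E : List TrueEq) (Q : ℕ → ℕ) (n : ℕ)

theorem conj_sat_iff {L : Type} [Lattice L] (v : ℕ → L) : (y.conj M fs E Q n).Sat v ↔
    (((y.map fun t => t.1.eval v).instanceEq Q n).1 =
      ((y.map fun t => t.1.eval v).instanceEq Q n).2) ∧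
    ∀ e ∈ (y.map fun t => t.1.eval v).eqs M fs E, e.1 = e.2 := by
  rw [← map_instanceEq (fun _ _ => rfl) (fun _ _ => rfl),
    ← map_eqs (fun _ _ => rfl) (fun _ _ => rfl), List.forall_mem_map, LatConj.Sat, conj,
    List.forall_mem_map, List.forall_mem_cons]
  rfl

end Pattern

theorem LatConj.mem_vars {Φ : LatConj} {i : ℕ} :
    i ∈ Φ.vars ↔ ∃ p ∈ Φ, i ∈ p.1.vars ∪ p.2.vars := by
  induction Φ with
  | nil => simp [LatConj.vars]
  | cons p Φ ih =>
    rw [show LatConj.vars (p :: Φ) = p.1.vars ∪ p.2.vars ∪ LatConj.vars Φ from rfl,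
      Finset.mem_union, ih]
    simp only [List.mem_cons, exists_eq_or_imp]

namespace Pattern

variable (y : Pattern FiveTerm) (M : ℕ) (fs : List (ℕ → ℕ)) (E : List TrueEq) (Q : ℕ → ℕ) (n : ℕ)

theorem conj_vars_subset : (y.conj M fs E Q n).vars ⊆ Finset.range 5 := by
  intro i hi
  obtain ⟨p, hp, hi⟩ := LatConj.mem_vars.1 hi
  obtain ⟨e, -, rfl⟩ := List.mem_map.1 hp
  exact Finset.union_subset e.1.2 e.2.2 hi

theorem mem_conj_vars {i : ℕ} (hi : i < 5) (hx : (y.x i).1 = .var i) :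
    i ∈ (y.conj M fs E Q n).vars := by
  refine LatConj.mem_vars.2 ⟨_, List.mem_map_of_mem (a := leEq y.b (y.x i)) ?_, ?_⟩
  · refine List.mem_cons_of_mem _ (List.mem_append_left _ ?_)
    simp only [chainEqs, List.append_assoc]
    exact List.mem_append_left _ (List.mem_map_of_mem (List.mem_range.2 hi))
  · refine Finset.mem_union_left _ (Finset.mem_union_right _ ?_)
    rw [hx]
    exact Finset.mem_singleton_self i

theorem exists_primrec_code_act (f : ℕ → ℕ) :
    ∃ step : ℕ → ℕ, Primrec step ∧ ∀ p : FiveTerm, (y.act f p).1.code = step p.1.code := by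
  have hstep (a b : ℕ) : Primrec fun s => 3 * Nat.pair s a + b :=
    Primrec.nat_add.comp (Primrec.nat_mul.comp (.const 3)
      (Primrec₂.natPair.comp .id (.const a))) (.const b)
  exact ⟨_, ((hstep (y.u 0).1.code 2).comp (hstep (y.c 0).1.code 1)).comp
    ((hstep (y.u 1).1.code 2).comp (hstep (y.F f).1.code 1)), fun _ => rfl⟩

theorem computable_conj_code : Computable fun n => (y.conj M fs E Q n).code := by
  obtain ⟨s, hs, hs'⟩ := y.exists_primrec_code_act Nat.succ
  obtain ⟨q, hq, hq'⟩ := y.exists_primrec_code_act Q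
  have hiter (n : ℕ) : ((y.act Nat.succ)^[n] y.z).1.code = s^[n] y.z.1.code :=
    (show Function.Semiconj (fun p : FiveTerm => p.1.code) (y.act Nat.succ) s from
      hs').iterate_right n y.z
  have hprim : Primrec fun n => Nat.succ (Nat.pair (Nat.pair (q (s^[n] y.z.1.code))
      (y.act Nat.succ y.z).1.code) (LatConj.code ((y.eqs M fs E).map
        (Prod.map Subtype.val Subtype.val)))) :=
    Primrec.succ.comp (Primrec₂.natPair.comp (Primrec₂.natPair.comp
      (hq.comp (Primrec.nat_iterate .id (.const _) (hs.comp .snd).to₂)) (.const _)) (.const _))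
  refine hprim.to_comp.of_eq fun n => ?_
  rw [← hiter, ← hq']
  rfl

end Pattern

theorem standardGenerators_zero_ne_one (fs : List (ℕ → ℕ)) :
    standardGenerators fs 0 ≠ standardGenerators fs 1 := by
  intro h
  let w : ℕ → OpSpace := Pi.single 0 (Finsupp.single (0, 0) 1)
  have hw : w ∈ standardGenerators fs 0 := fun t ht =>
    Pi.single_eq_of_ne (fun h0 : t = 0 => ht (by simp [h0])) _
  rw [h] at hw
  have h0 : w 0 = 0 := hw 0 fun h1 => absurd h1.1 (by decide)
  simp [w] at h0

/-- The entries of the standard solution are values of terms in five variables. -/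
theorem exists_standard_pattern (fs : List (ℕ → ℕ)) : ∃ y : Pattern FiveTerm,
    (∀ i < 5, (y.x i).1 = .var i) ∧
    IsStandard fs (y.map fun t => t.1.eval (standardGenerators fs)) := by
  have hterm (a : Submodule ℚ (ℕ → OpSpace)) : ∃ t : FiveTerm,
      Generated (standardGenerators fs) a → t.1.eval (standardGenerators fs) = a := by
    by_cases ha : Generated (standardGenerators fs) a
    · obtain ⟨t, ht, hta⟩ := ha
      exact ⟨⟨t, ht⟩, fun _ => hta⟩
    · exact ⟨⟨.var 0, by simp [LatTerm.vars]⟩, fun h => absurd h ha⟩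
  choose T hT using hterm
  have hop {i j : ℕ} (hi : i < 4) (hj : j < 4) (hij : i ≠ j) {f : ℕ → ℕ} (hf : f ∈ fs) :
      Generated (standardGenerators fs) (graphAt i j (opMap f)) := by
    obtain ⟨l, hl, rfl⟩ := List.getElem_of_mem hf
    have h : storedMap fs (l + 1) = opMap fs[l] := by
      rw [storedMap, List.getD_eq_getElem _ _ hl]
    rw [← h]
    exact generated_graphAt (by omega) hi hj hij
  refine ⟨⟨fun i => if h : i < 5 then ⟨.var i, by simpa [LatTerm.vars] using h⟩ else T ⊥, T ⊥,
    fun t => T (supported ℚ OpSpace {t}), fun t => T (graphAt t (t + 1) LinearMap.id),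
    T (placeAt 0 (level 0)), T (graphAt 0 1 embedLevel), fun f => T (graphAt 0 1 (opMap f)),
    fun f => T (graphAt 1 2 (opMap f))⟩, fun i hi => by simp [hi], ?_⟩
  exact {
    x := fun i hi => by simp [Pattern.map, hi, LatTerm.eval]
    b := hT _ generated_bot
    u := fun t ht => hT _ (generated_coordinate ht)
    c := fun t ht => hT _ (generated_graphAt_succ ht)
    z := hT _ generated_placeAt
    j := hT _ (generated_graphAt (R := storedMap fs) (i := 0) (by omega) (by decide) (by decide)
      (by decide))
    F := fun f hf => hT _ (hop (by decide) (by decide) (by decide) hf)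
    G := fun f hf => hT _ (hop (by decide) (by decide) (by decide) hf) }

/-! ### Undecidability -/

/-- Every recursively enumerable set is many-one reducible to the inconsistent conjunctions. -/
theorem exists_computable_reduction {K : ℕ → Prop} {g : ℕ → ℕ → ℕ} (hg : Primrec₂ g)
    (hK : ∀ n, K n ↔ ∃ k, g k n = 0) : ∃ Φ : ℕ → LatConj,
    (Computable fun n => (Φ n).code) ∧ ∀ n, (Φ n).vars ⊆ Finset.range 5 ∧
      (K n ↔ ¬ ∃ (L : Type) (_ : Lattice L) (_ : IsModularLattice L) (v : ℕ → L),
        (Φ n).Sat v ∧ (Φ n).Nontriv v) := by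
  obtain ⟨E, Q, hQ, hmodel⟩ := exists_unary_presentation (Nat.Primrec'.prim_iff₂.2 hg) hK
  let fs : List (ℕ → ℕ) := [id, fun _ => 0, Nat.succ, Q] ++
    E.toList.flatMap fun q => [q.1.1.1, q.1.1.2, q.1.2.1, q.1.2.2]
  have hfs : ∀ q ∈ E.toList, q.1.1.1 ∈ fs ∧ q.1.1.2 ∈ fs ∧ q.1.2.1 ∈ fs ∧ q.1.2.2 ∈ fs := by
    intro q hq
    have h (f : ℕ → ℕ) (hf : f ∈ [q.1.1.1, q.1.1.2, q.1.2.1, q.1.2.2]) : f ∈ fs :=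
      List.mem_append_right _ (List.mem_flatMap.2 ⟨q, hq, hf⟩)
    exact ⟨h _ (by simp), h _ (by simp), h _ (by simp), h _ (by simp)⟩
  obtain ⟨y, hx, hy⟩ := exists_standard_pattern fs
  refine ⟨y.conj (chainLength fs) fs E.toList Q, y.computable_conj_code _ _ _ _,
    fun n => ⟨y.conj_vars_subset _ _ _ _ _, fun hn => ?_, fun hn => ?_⟩⟩
  · rintro ⟨L, _, _, v, hsat, i, hi, j, hj, hij⟩
    obtain ⟨h1, h2⟩ := (y.conj_sat_iff _ _ _ _ _ v).1 hsat
    have key {i : ℕ} (hi : i < 5) : v i = y.b.1.eval v := by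
      have h := Pattern.collapse (by simp [chainLength]) (fun q hq => hfs q (by simpa using hq))
        h2 (fun P m => hmodel P m n hn) h1 hi
      simpa [Pattern.map, hx i hi, LatTerm.eval] using h
    have hlt {i : ℕ} (hi : i ∈ (y.conj (chainLength fs) fs E.toList Q n).vars) : i < 5 :=
      Finset.mem_range.1 (y.conj_vars_subset _ _ _ _ _ hi)
    exact hij ((key (hlt hi)).trans (key (hlt hj)).symm)
  · by_contra hKn
    refine hn ⟨Submodule ℚ (ℕ → OpSpace), inferInstance, inferInstance, standardGenerators fs,
      (y.conj_sat_iff _ _ _ _ _ _).2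
        ⟨hy.sat_instanceEq (by simp [fs]) (by simp [fs]) (hQ n hKn), ?_⟩,
      0, y.mem_conj_vars _ _ _ _ _ (by decide) (hx 0 (by decide)),
      1, y.mem_conj_vars _ _ _ _ _ (by decide) (hx 1 (by decide)),
      standardGenerators_zero_ne_one fs⟩
    simp only [Pattern.eqs, List.forall_mem_append]
    exact ⟨hy.sat_chainEqs, hy.sat_frameEqs (by simp [fs]) (by simp [fs]) (by simp [fs]),
      hy.sat_symbolEqs, hy.sat_relationEqs hfs⟩

open Nat.Partrec in
theorem code_eval_dom_iff (c : Code) :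
    (c.eval 0).Dom ↔ ∃ k, (if (c.evaln k 0).isSome then 0 else 1) = 0 := by
  simp only [Part.dom_iff_mem, Code.evaln_complete, Option.mem_def, ite_eq_left_iff, one_ne_zero,
    imp_false, not_not, Option.isSome_iff_exists]
  exact exists_comm

/-- The consistency problem for modular lattices is
unsolvable even when restricted to conjunctions of lattice equations in the
five variables `x₁, …, x₅`: no computable function decides, for conjunctions
all of whose variables lie among the first five, whether they admit a
non-trivial satisfying assignment in some modular lattice. -/
theorem modular_lattice_consistency_undecidable_five_variables :
    ¬ ∃ f : ℕ → Bool, Computable f ∧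
      ∀ Φ : LatConj, Φ.vars ⊆ Finset.range 5 →
        (f Φ.code = true ↔
          ∃ (L : Type) (_ : Lattice L) (_ : IsModularLattice L) (v : ℕ → L),
            Φ.Sat v ∧ Φ.Nontriv v) := by
  rintro ⟨f, hf, hfΦ⟩
  have hg : Primrec₂ fun k n : ℕ => if ((Denumerable.ofNat Nat.Partrec.Code n).evaln k 0).isSome
      then 0 else 1 := by
    refine Primrec.ite (Primrec.eq.comp (Primrec.option_isSome.comp
      (Nat.Partrec.Code.primrec_evaln.comp ((Primrec.pair .fst
        ((Primrec.ofNat _).comp .snd)).pair (.const 0)))) (.const true)) (.const 0) (.const 1)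
  obtain ⟨Φ, hΦ, hΦK⟩ := exists_computable_reduction hg fun n => code_eval_dom_iff _
  refine ComputablePred.halting_problem 0 (ComputablePred.computable_iff.2
    ⟨fun c => !f (Φ (Encodable.encode c)).code,
      Primrec.not.to_comp.comp (hf.comp (hΦ.comp .encode)), funext fun c => propext ?_⟩)
  obtain ⟨hvars, hiff⟩ := hΦK (Encodable.encode c)
  rw [← hfΦ _ hvars, Denumerable.ofNat_encode] at hiff
  simpa using hiff
end

section
/- A database D with attribute set U and relation R satisfies every functional dependency X → Y and every embedded multivalued dependency [X, Y] (for all nonempty X, Y ⊆ U) if and only if U is a singleton set or R is a singleton set. -/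
/-- A database (under the pure universal relation assumption): a finite nonempty
set `attr` of attributes (coded as natural numbers), a domain `val x` of values
for each attribute `x`, and a nonempty relation `rel` of tuples, a tuple being a
function assigning to each attribute `x ∈ attr` a value in `val x`. -/
structure DB : Type 1 where
  attr : Finset ℕ
  attr_nonempty : attr.Nonempty
  val : ℕ → Type
  rel : Set ((x : {x // x ∈ attr}) → val x.1)
  rel_nonempty : rel.Nonempty

/-- `s[X] = t[X]`: the tuples `s` and `t` agree on all attributes in `X`. -/
def DB.agree (D : DB) (s t : (x : {x // x ∈ D.attr}) → D.val x.1)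
    (X : Finset ℕ) : Prop :=
  ∀ x : {x // x ∈ D.attr}, x.1 ∈ X → s x = t x

/-- `D` satisfies the functional dependency `X → Y`. -/
def DB.SatFD (D : DB) (X Y : Finset ℕ) : Prop :=
  ∀ s ∈ D.rel, ∀ t ∈ D.rel, D.agree s t X → D.agree s t Y

/-- `D` satisfies the embedded multivalued dependency `[X, Y]`. -/
def DB.SatEMVD (D : DB) (X Y : Finset ℕ) : Prop :=
  ∀ t₁ ∈ D.rel, ∀ t₂ ∈ D.rel, D.agree t₁ t₂ (X ∩ Y) →
    ∃ t ∈ D.rel, D.agree t t₁ X ∧ D.agree t t₂ Y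


/-- Two tuples of a database satisfying `X → attr` that agree on `X` are equal. -/
theorem DB.SatFD.eq_of_agree {D : DB} {X : Finset ℕ} (h : D.SatFD X D.attr)
    {s t : (x : {x // x ∈ D.attr}) → D.val x.1} (hs : s ∈ D.rel) (ht : t ∈ D.rel)
    (hst : D.agree s t X) : s = t :=
  funext fun x => h s hs t ht hst x x.2

/-- A database `D` satisfies every functional dependency
`X → Y` and every embedded multivalued dependency `[X, Y]` (for all nonempty
`X, Y ⊆ attr`) if and only if its attribute set is a singleton or its relation
is a singleton. -/
theorem database_trivial_iff (D : DB) :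
    ((∀ X Y : Finset ℕ, X.Nonempty → Y.Nonempty → X ⊆ D.attr → Y ⊆ D.attr →
        D.SatFD X Y) ∧
     (∀ X Y : Finset ℕ, X.Nonempty → Y.Nonempty → X ⊆ D.attr → Y ⊆ D.attr →
        D.SatEMVD X Y)) ↔
    ((∃ x, D.attr = {x}) ∨ (∃ t, D.rel = {t})) := by
  constructor
  · rintro ⟨hFD, hEMVD⟩
    rcases D.attr_nonempty.exists_eq_singleton_or_nontrivial with h | ⟨x, hx, y, hy, hxy⟩
    · exact Or.inl h
    · right
      have hkey : ∀ z ∈ D.attr, D.SatFD {z} D.attr := fun z hz =>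
        hFD _ _ (Finset.singleton_nonempty z) D.attr_nonempty
          (Finset.singleton_subset_iff.2 hz) subset_rfl
      obtain ⟨t₁, ht₁⟩ := D.rel_nonempty
      refine ⟨t₁, Set.eq_singleton_iff_unique_mem.2 ⟨ht₁, fun t₂ ht₂ => ?_⟩⟩
      obtain ⟨t, ht, h₁, h₂⟩ := hEMVD {x} {y} (Finset.singleton_nonempty x)
        (Finset.singleton_nonempty y) (Finset.singleton_subset_iff.2 hx)
        (Finset.singleton_subset_iff.2 hy) t₁ ht₁ t₂ ht₂ (fun z hz => by simp_all)
      exact ((hkey y hy).eq_of_agree ht ht₂ h₂).symm.trans ((hkey x hx).eq_of_agree ht ht₁ h₁)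
  · rintro (⟨x, hx⟩ | ⟨t, ht⟩)
    · have hfull : ∀ X : Finset ℕ, X.Nonempty → X ⊆ D.attr → X = {x} := fun X hX hXU =>
        hX.subset_singleton_iff.1 (hx ▸ hXU)
      constructor
      · intro X Y hX hY hXU hYU
        rw [hfull X hX hXU, hfull Y hY hYU]
        exact fun _ _ _ _ h => h
      · intro X Y hX hY hXU hYU
        rw [hfull X hX hXU, hfull Y hY hYU]
        intro t₁ ht₁ t₂ _ h
        rw [Finset.inter_self] at h
        exact ⟨t₁, ht₁, fun _ _ => rfl, h⟩
    · have heq : ∀ s ∈ D.rel, s = t := fun s hs => by simpa [ht] using hs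
      constructor
      · intro X Y _ _ _ _ s₁ h₁ s₂ h₂ _ z _
        rw [heq s₁ h₁, heq s₂ h₂]
      · intro X Y _ _ _ _ s₁ h₁ s₂ h₂ _
        rw [heq s₁ h₁, heq s₂ h₂]
        exact ⟨t, heq s₁ h₁ ▸ h₁, fun _ _ => rfl, fun _ _ => rfl⟩
end
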